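/- arXiv:1707.02395 — 7 statements merged into one kernel-verified Lean document; each statement's English description precedes it below -/
import Mathlib

section
/- Let G : ℝ² → ℂ be Lebesgue integrable, let d > 0 and k > 0, and set λ = 2π/k and ℓ = √(d/(2k)). Define the Fresnel propagator h(x, x') = (exp(i k d)/√(i λ d)) · exp(i k (x − x')²/(2d)), where √(iλd) denotes the principal square root. Then for all x₁, x₂ ∈ ℝ, writing y₁ = (x₁ + x₂)/2 and y₂ = (x₁ − x₂)/2, one has ∬_{ℝ²} G(x₁', x₂') h(x₁, x₁') · conj(h(x₂, x₂')) dx₁' dx₂' = (1/(2πℓ²)) ∬_{ℝ²} G(y₁' + y₂', y₁' − y₂') · exp( i (y₁ − y₁')(y₂ − y₂')/ℓ² ) dy₁' dy₂'. -/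
open MeasureTheory Complex

/-- The linear map `(a, b) ↦ (a + b, a - b)` of the plane has determinant `-2`. -/
lemma det_add_sub :
    LinearMap.det ((LinearMap.fst ℝ ℝ ℝ + LinearMap.snd ℝ ℝ ℝ).prod
      (LinearMap.fst ℝ ℝ ℝ - LinearMap.snd ℝ ℝ ℝ)) = -2 := by
  rw [← LinearMap.det_toMatrix (Module.Basis.finTwoProd ℝ), Matrix.det_fin_two]
  simp [LinearMap.toMatrix_apply]
  norm_num

/-- Integration over the plane in the rotated coordinates `p = (a + b, a - b)`. -/
lemma integral_eq_two_smul_integral_add_sub {E : Type*} [NormedAddCommGroup E] [NormedSpace ℝ E]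
    (F : ℝ × ℝ → E) :
    ∫ p, F p = (2 : ℝ) • ∫ q : ℝ × ℝ, F (q.1 + q.2, q.1 - q.2) := by
  let L : ℝ × ℝ →L[ℝ] ℝ × ℝ :=
    (ContinuousLinearMap.fst ℝ ℝ ℝ + ContinuousLinearMap.snd ℝ ℝ ℝ).prod
      (ContinuousLinearMap.fst ℝ ℝ ℝ - ContinuousLinearMap.snd ℝ ℝ ℝ)
  have hdet : L.det = -2 := det_add_sub
  have hL (q : ℝ × ℝ) : L q = (q.1 + q.2, q.1 - q.2) := rfl
  have hinj : Function.Injective L := by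
    rintro ⟨a, b⟩ ⟨a', b'⟩ h
    simp only [hL, Prod.mk.injEq] at h ⊢
    constructor <;> linarith
  have hsurj : Function.Surjective L := fun p ↦
    ⟨((p.1 + p.2) / 2, (p.1 - p.2) / 2), by rw [hL]; ext <;> ring⟩
  have key := integral_image_eq_integral_abs_det_fderiv_smul volume MeasurableSet.univ
    (fun x _ ↦ (L.hasFDerivAt (x := x)).hasFDerivWithinAt) hinj.injOn F
  rw [Set.image_univ, hsurj.range_eq, setIntegral_univ, setIntegral_univ, hdet,
    integral_smul] at key
  simpa [hL] using key

/-- The squared modulus of the principal square root of `z` is the modulus of `z`. -/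
lemma sq_norm_cpow_half (z : ℂ) : ‖z ^ ((1 : ℂ) / 2)‖ ^ 2 = ‖z‖ := by
  rw [← norm_pow, one_div]
  exact congrArg norm (cpow_nat_inv_pow z two_ne_zero)

/-- Fresnel propagation of a coherence function rewritten in rotated coordinates
`y₁ = (x₁ + x₂)/2`, `y₂ = (x₁ - x₂)/2`. -/
theorem fresnel_propagation_rotated_coordinates
    (G : ℝ × ℝ → ℂ) (hG : Integrable G)
    (d k lam ℓ : ℝ) (hd : 0 < d) (hk : 0 < k)
    (hlam : lam = 2 * Real.pi / k)
    (hℓ : ℓ = Real.sqrt (d / (2 * k)))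
    (h : ℝ → ℝ → ℂ)
    (hh : ∀ x x' : ℝ, h x x' =
      (Complex.exp (Complex.I * ((k * d : ℝ) : ℂ)) /
          ((Complex.I * (lam : ℂ) * (d : ℂ)) ^ ((1 : ℂ) / 2))) *
        Complex.exp (Complex.I * (((k * (x - x') ^ 2) / (2 * d) : ℝ) : ℂ)))
    (x₁ x₂ y₁ y₂ : ℝ) (hy₁ : y₁ = (x₁ + x₂) / 2) (hy₂ : y₂ = (x₁ - x₂) / 2) :
    (∫ p : ℝ × ℝ, G p * h x₁ p.1 * (starRingEnd ℂ) (h x₂ p.2)) =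
      ((1 / (2 * Real.pi * ℓ ^ 2) : ℝ) : ℂ) *
        ∫ q : ℝ × ℝ, G (q.1 + q.2, q.1 - q.2) *
          Complex.exp (Complex.I * ((((y₁ - q.1) * (y₂ - q.2)) / ℓ ^ 2 : ℝ) : ℂ)) := by
  have hℓ2 : ℓ ^ 2 = d / (2 * k) := by rw [hℓ, Real.sq_sqrt (by positivity)]
  have hlam0 : 0 < lam := by rw [hlam]; positivity
  set c : ℂ := Complex.exp (Complex.I * ((k * d : ℝ) : ℂ)) /
    ((Complex.I * (lam : ℂ) * (d : ℂ)) ^ ((1 : ℂ) / 2)) with hc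
  have hcc : c * (starRingEnd ℂ) c = ((1 / (4 * Real.pi * ℓ ^ 2) : ℝ) : ℂ) := by
    rw [mul_conj, normSq_eq_norm_sq, hc, norm_div, norm_exp_I_mul_ofReal, div_pow,
      sq_norm_cpow_half, norm_mul, norm_mul, norm_I, norm_real, norm_real,
      Real.norm_of_nonneg hlam0.le, Real.norm_of_nonneg hd.le, hℓ2, hlam]
    congr 1
    field_simp
    norm_num
  have hkernel (q : ℝ × ℝ) : h x₁ (q.1 + q.2) * (starRingEnd ℂ) (h x₂ (q.1 - q.2)) =
      ((1 / (4 * Real.pi * ℓ ^ 2) : ℝ) : ℂ) *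
        Complex.exp (Complex.I * ((((y₁ - q.1) * (y₂ - q.2)) / ℓ ^ 2 : ℝ) : ℂ)) := by
    rw [hh, hh, map_mul, mul_mul_mul_comm, hcc, ← exp_conj, ← Complex.exp_add, map_mul, conj_I,
      conj_ofReal, neg_mul, ← sub_eq_add_neg, ← mul_sub, ← ofReal_sub, hℓ2, hy₁, hy₂]
    congr 4
    field_simp
    ring
  rw [integral_eq_two_smul_integral_add_sub, real_smul]
  simp only [mul_assoc (G _), hkernel, mul_left_comm (G _)]
  rw [integral_const_mul, ← mul_assoc, ← ofReal_mul]
  congr 2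
  field_simp
  norm_num
end

section
/- Let A₀, w₀, σ₀, d₀, k > 0, set ℓ₀ = √(d₀/(2k)) and ξ₀ = ℓ₀²/(w₀σ₀). Define A = A₀/√(1 + ξ₀²), R = ℓ₀√(1 + ξ₀²)/ξ₀, w = w₀√(1 + ξ₀²), σ = σ₀√(1 + ξ₀²). Then for all y₁, y₂ ∈ ℝ: (1/(2πℓ₀²)) ∬_{ℝ²} A₀ N^{w₀}(y₁') N^{σ₀}(y₂') exp( i (y₁ − y₁')(y₂ − y₂')/ℓ₀² ) dy₁' dy₂' = A · exp(i y₁ y₂ / R²) · N^{w}(y₁) · N^{σ}(y₂). -/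
open MeasureTheory Complex

/-- The Gaussian `N^β(x) = exp(-x²/(2β²))`. -/
noncomputable def gaussN (β x : ℝ) : ℝ := Real.exp (-(x ^ 2) / (2 * β ^ 2))

/-- The Gaussian integral with real quadratic coefficient and complex affine part. -/
theorem integral_cexp_neg_real_quadratic {a : ℝ} (ha : 0 < a) (c d : ℂ) :
    ∫ x : ℝ, cexp (-(a : ℂ) * x ^ 2 + c * x + d) =
      (Real.sqrt (Real.pi / a) : ℂ) * cexp (d + c ^ 2 / (4 * a)) := by
  rw [integral_cexp_quadratic (by simpa using ha), neg_neg, Real.sqrt_eq_rpow,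
    Complex.ofReal_cpow (by positivity)]
  push_cast
  congr 2
  rw [mul_neg, div_neg, sub_neg_eq_add]

theorem integrable_gaussN {β : ℝ} (hβ : 0 < β) : Integrable (gaussN β) := by
  refine (integrable_exp_neg_mul_sq (b := 1 / (2 * β ^ 2)) (by positivity)).congr
    (Filter.Eventually.of_forall fun x => ?_)
  simp only [gaussN]
  congr 1
  ring

theorem integrable_gaussN_mul_cexp (A L y₁ y₂ : ℝ) {w σ : ℝ} (hw : 0 < w) (hσ : 0 < σ) :
    Integrable fun q : ℝ × ℝ => ((A * gaussN w q.1 * gaussN σ q.2 : ℝ) : ℂ) *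
      cexp (I * ((((y₁ - q.1) * (y₂ - q.2)) / L : ℝ) : ℂ)) := by
  have h : Integrable fun q : ℝ × ℝ => ((A * gaussN w q.1 * gaussN σ q.2 : ℝ) : ℂ) :=
    (((integrable_gaussN hw).const_mul A).mul_prod (integrable_gaussN hσ)).ofReal
  refine h.mul_bdd (c := 1) (Continuous.aestronglyMeasurable (by fun_prop))
    (Filter.Eventually.of_forall fun q => ?_)
  rw [mul_comm I, norm_exp_ofReal_mul_I]

/-- The Fresnel integral of a product of Gaussians, in closed form. -/
theorem integral_gaussN_mul_cexp (A y₁ y₂ : ℝ) {L w σ s : ℝ} (hL : 0 < L) (hw : 0 < w)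
    (hσ : 0 < σ) (hs : 0 < s) (hs2 : s ^ 2 = 1 + (L / (w * σ)) ^ 2) :
    ∫ q : ℝ × ℝ, ((A * gaussN w q.1 * gaussN σ q.2 : ℝ) : ℂ) *
        cexp (I * ((((y₁ - q.1) * (y₂ - q.2)) / L : ℝ) : ℂ)) =
      ((2 * Real.pi * L * (A / s) : ℝ) : ℂ) *
        cexp (I * ((y₁ * y₂ * (L / (w * σ)) ^ 2 / (L * s ^ 2) : ℝ) : ℂ)) *
        ((gaussN (w * s) y₁ : ℝ) : ℂ) * ((gaussN (σ * s) y₂ : ℝ) : ℂ) := by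
  have hL' : (L : ℂ) ≠ 0 := by exact_mod_cast hL.ne'
  have hw' : (w : ℂ) ≠ 0 := by exact_mod_cast hw.ne'
  have hσ' : (σ : ℂ) ≠ 0 := by exact_mod_cast hσ.ne'
  have hs' : (s : ℂ) ≠ 0 := by exact_mod_cast hs.ne'
  have hs2L : w ^ 2 * σ ^ 2 * s ^ 2 = w ^ 2 * σ ^ 2 + L ^ 2 := by
    rw [hs2]; field_simp
  have hs2C : (w : ℂ) ^ 2 * σ ^ 2 * s ^ 2 = w ^ 2 * σ ^ 2 + L ^ 2 := by exact_mod_cast hs2L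
  have inner : ∀ x : ℝ, ∫ y : ℝ, ((A * gaussN w x * gaussN σ y : ℝ) : ℂ) *
        cexp (I * ((((y₁ - x) * (y₂ - y)) / L : ℝ) : ℂ)) =
      ((A * Real.sqrt (Real.pi / (1 / (2 * σ ^ 2))) : ℝ) : ℂ) *
        cexp (-((σ ^ 2 * s ^ 2 / (2 * L ^ 2) : ℝ) : ℂ) * x ^ 2 +
          (σ ^ 2 * y₁ / L ^ 2 - I * y₂ / L) * x +
          (I * y₁ * y₂ / L - σ ^ 2 * y₁ ^ 2 / (2 * L ^ 2))) := by
    intro x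
    have h : ∀ y : ℝ, ((A * gaussN w x * gaussN σ y : ℝ) : ℂ) *
        cexp (I * ((((y₁ - x) * (y₂ - y)) / L : ℝ) : ℂ)) =
        A * cexp (-((1 / (2 * σ ^ 2) : ℝ) : ℂ) * y ^ 2 + (-(I * (y₁ - x) / L)) * y +
          (-(x ^ 2) / (2 * w ^ 2) + I * (y₁ - x) * y₂ / L)) := by
      intro y
      simp only [gaussN]
      push_cast
      rw [mul_assoc, mul_assoc, ← Complex.exp_add, ← Complex.exp_add]
      congr 2
      ring
    simp_rw [h]
    rw [integral_const_mul, integral_cexp_neg_real_quadratic (by positivity), ← mul_assoc,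
      ← Complex.ofReal_mul]
    congr 2
    push_cast
    field_simp
    ring_nf
    simp only [I_sq]
    linear_combination 4 * (x : ℂ) ^ 2 * hs2C
  have hsqrt : Real.sqrt (Real.pi / (1 / (2 * σ ^ 2))) *
      Real.sqrt (Real.pi / (σ ^ 2 * s ^ 2 / (2 * L ^ 2))) = 2 * Real.pi * L / s := by
    rw [← Real.sqrt_mul (by positivity), ← Real.sqrt_sq (by positivity : 0 ≤ 2 * Real.pi * L / s)]
    congr 1
    field_simp
  rw [Measure.volume_eq_prod, integral_prod _ (integrable_gaussN_mul_cexp A L y₁ y₂ hw hσ)]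
  simp_rw [inner]
  rw [integral_const_mul, integral_cexp_neg_real_quadratic (by positivity), ← mul_assoc,
    ← Complex.ofReal_mul, mul_assoc A, hsqrt]
  simp only [gaussN, Complex.ofReal_exp]
  simp only [mul_assoc, ← Complex.exp_add]
  congr 1
  · push_cast
    ring
  · congr 1
    push_cast
    field_simp
    ring_nf
    simp only [I_sq]
    linear_combination (8 * y₁ * I * y₂ * L - 4 * y₁ ^ 2 * σ ^ 2) * hs2C

/-- Free Fresnel propagation (in rotated coordinates, over a distance `d₀`) of the
coherence function of a flat-phase Gauss-Schell source preserves the Gauss-Schell form. -/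
theorem gauss_schell_free_propagation
    (A₀ w₀ σ₀ d₀ k : ℝ) (hA₀ : 0 < A₀) (hw₀ : 0 < w₀) (hσ₀ : 0 < σ₀)
    (hd₀ : 0 < d₀) (hk : 0 < k)
    (ℓ₀ ξ₀ A R w σ : ℝ)
    (hℓ₀ : ℓ₀ = Real.sqrt (d₀ / (2 * k)))
    (hξ₀ : ξ₀ = ℓ₀ ^ 2 / (w₀ * σ₀))
    (hA : A = A₀ / Real.sqrt (1 + ξ₀ ^ 2))
    (hR : R = ℓ₀ * Real.sqrt (1 + ξ₀ ^ 2) / ξ₀)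
    (hw : w = w₀ * Real.sqrt (1 + ξ₀ ^ 2))
    (hσ : σ = σ₀ * Real.sqrt (1 + ξ₀ ^ 2))
    (y₁ y₂ : ℝ) :
    ((1 / (2 * Real.pi * ℓ₀ ^ 2) : ℝ) : ℂ) *
        ∫ q : ℝ × ℝ, ((A₀ * gaussN w₀ q.1 * gaussN σ₀ q.2 : ℝ) : ℂ) *
          Complex.exp (Complex.I * ((((y₁ - q.1) * (y₂ - q.2)) / ℓ₀ ^ 2 : ℝ) : ℂ)) =
      ((A : ℝ) : ℂ) * Complex.exp (Complex.I * (((y₁ * y₂) / R ^ 2 : ℝ) : ℂ)) *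
        ((gaussN w y₁ : ℝ) : ℂ) * ((gaussN σ y₂ : ℝ) : ℂ) := by
  have hℓ : 0 < ℓ₀ := by rw [hℓ₀]; positivity
  have hξ : 0 < ξ₀ := by rw [hξ₀]; positivity
  have hs : 0 < Real.sqrt (1 + ξ₀ ^ 2) := by positivity
  have hs2 : Real.sqrt (1 + ξ₀ ^ 2) ^ 2 = 1 + (ℓ₀ ^ 2 / (w₀ * σ₀)) ^ 2 := by
    rw [Real.sq_sqrt (by positivity), hξ₀]
  rw [integral_gaussN_mul_cexp A₀ y₁ y₂ (by positivity) hw₀ hσ₀ hs hs2, ← hξ₀, ← hw, ← hσ,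
    ← mul_assoc, ← mul_assoc, ← mul_assoc, ← Complex.ofReal_mul]
  congr 5
  · rw [hA]
    field_simp
  · rw [hR]
    field_simp
end

section
/- Let A, w, σ, R, d, k > 0, set ℓ = √(d/(2k)), δ = ℓ²/R², and ξ = ℓ²/(wσ(1 + δ)). Define Ã = A/((1 + δ)√(1 + ξ²)), R̃ = R·√( (1 + δ)(1 + ξ²) / (1 + (1 + 1/δ)ξ²) ), w̃ = w(1 + δ)√(1 + ξ²), σ̃ = σ(1 + δ)√(1 + ξ²). Then for all y₁, y₂ ∈ ℝ: (1/(2πℓ²)) ∬_{ℝ²} A · exp(i y₁' y₂' / R²) N^{w}(y₁') N^{σ}(y₂') · exp( i (y₁ − y₁')(y₂ − y₂')/ℓ² ) dy₁' dy₂' = Ã · exp(i y₁ y₂ / R̃²) · N^{w̃}(y₁) · N^{σ̃}(y₂). -/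
open MeasureTheory Complex

/-- One-dimensional Gaussian integral with a real quadratic coefficient, normalised by a real
square root. -/
theorem integral_cexp_neg_mul_sq_add {b : ℝ} (hb : 0 < b) (u v : ℂ) :
    ∫ x : ℝ, cexp (-(b : ℂ) * (x : ℂ) ^ 2 + u * x + v) =
      (Real.sqrt (Real.pi / b) : ℂ) * cexp (v + u ^ 2 / (4 * b)) := by
  have h := integral_cexp_quadratic (b := -(b : ℂ)) (by simpa using hb) u v
  have hs : ((Real.pi : ℂ) / -(-(b : ℂ))) ^ (1 / 2 : ℂ) = (Real.sqrt (Real.pi / b) : ℂ) := by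
    rw [Real.sqrt_eq_rpow, Complex.ofReal_cpow (by positivity)]
    push_cast
    rw [neg_neg]
  rw [h, hs]
  congr 2
  rw [mul_neg, div_neg, sub_neg_eq_add]

/-- The integrand of a two-dimensional oscillating Gaussian integral is integrable. -/
theorem integrable_cexp_gaussian_bilinear {a b : ℝ} (ha : 0 < a) (hb : 0 < b) (c p q : ℝ) :
    Integrable (fun z : ℝ × ℝ => cexp (-(a : ℂ) * (z.1 : ℂ) ^ 2 - (b : ℂ) * (z.2 : ℂ) ^ 2 +
      I * (c * z.1 * z.2 + p * z.1 + q * z.2))) := by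
  refine ((integrable_exp_neg_mul_sq ha).mul_prod (integrable_exp_neg_mul_sq hb)).mono'
    (Continuous.aestronglyMeasurable (by fun_prop)) (Filter.Eventually.of_forall fun z => ?_)
  rw [Complex.norm_exp, ← Real.exp_add]
  refine (congrArg Real.exp ?_).le
  have : (-(a : ℂ) * (z.1 : ℂ) ^ 2 - (b : ℂ) * (z.2 : ℂ) ^ 2 +
      I * (c * z.1 * z.2 + p * z.1 + q * z.2)) =
      ((-a * z.1 ^ 2 + -b * z.2 ^ 2 : ℝ) : ℂ) +
        ((c * z.1 * z.2 + p * z.1 + q * z.2 : ℝ) : ℂ) * I := by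
    push_cast
    ring
  rw [this, Complex.add_re, Complex.re_ofReal_mul, Complex.I_re, Complex.ofReal_re]
  ring

/-- Two-dimensional Gaussian integral with a purely imaginary bilinear coupling. -/
theorem integral_cexp_gaussian_bilinear {a b : ℝ} (ha : 0 < a) (hb : 0 < b) (c p q : ℝ) :
    ∫ z : ℝ × ℝ, cexp (-(a : ℂ) * (z.1 : ℂ) ^ 2 - (b : ℂ) * (z.2 : ℂ) ^ 2 +
      I * (c * z.1 * z.2 + p * z.1 + q * z.2)) =
      ((2 * Real.pi / Real.sqrt (4 * a * b + c ^ 2) : ℝ) : ℂ) *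
        cexp (-(b * p ^ 2 + a * q ^ 2 + I * c * p * q) / (4 * a * b + c ^ 2)) := by
  have hD : 0 < 4 * a * b + c ^ 2 := by positivity
  have hB : 0 < (4 * a * b + c ^ 2) / (4 * b) := by positivity
  have hbC : (b : ℂ) ≠ 0 := by exact_mod_cast hb.ne'
  have hDC : (4 * a * b + c ^ 2 : ℂ) ≠ 0 := by exact_mod_cast hD.ne'
  rw [Measure.volume_eq_prod, integral_prod _
    (Measure.volume_eq_prod ℝ ℝ ▸ integrable_cexp_gaussian_bilinear ha hb c p q)]
  have inner_eq (x : ℝ) : ∫ y : ℝ, cexp (-(a : ℂ) * (x : ℂ) ^ 2 - (b : ℂ) * (y : ℂ) ^ 2 +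
      I * (c * x * y + p * x + q * y)) =
      (Real.sqrt (Real.pi / b) : ℂ) * cexp (-(((4 * a * b + c ^ 2) / (4 * b) : ℝ) : ℂ) * (x : ℂ) ^ 2
        + (I * p - c * q / (2 * b)) * x + -(q : ℂ) ^ 2 / (4 * b)) := by
    have h := integral_cexp_neg_mul_sq_add hb (I * (c * x + q)) (-(a : ℂ) * (x : ℂ) ^ 2 + I * p * x)
    refine (integral_congr_ae (Filter.Eventually.of_forall fun y => ?_)).trans (h.trans ?_)
    · refine congrArg cexp ?_
      ring
    · congr 2
      push_cast
      field_simp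
      ring_nf
      simp only [I_sq]
      ring
  simp only [inner_eq]
  rw [integral_const_mul, integral_cexp_neg_mul_sq_add hB, ← mul_assoc, ← Complex.ofReal_mul]
  congr 2
  · rw [← Real.sqrt_mul (by positivity), eq_div_iff (by positivity),
      ← Real.sqrt_mul (by positivity)]
    rw [show Real.pi / b * (Real.pi / ((4 * a * b + c ^ 2) / (4 * b))) * (4 * a * b + c ^ 2) =
      (2 * Real.pi) ^ 2 by field_simp; ring]
    exact Real.sqrt_sq (by positivity)
  · push_cast
    have hsq : (I * p - c * q / (2 * b) : ℂ) ^ 2 =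
        (c * q / (2 * b)) ^ 2 - p ^ 2 - I * p * c * q / b := by
      linear_combination (p : ℂ) ^ 2 * I_sq
    rw [hsq]
    field_simp
    linear_combination 4 * (q : ℂ) ^ 2 * mul_inv_cancel₀ hDC

/-- Free Fresnel propagation (in rotated coordinates, over a distance `d`) of the
standard Gauss-Schell coherence model with quadratic phase: the Gauss-Schell form is
propagation-invariant with transformed parameters `(Ã, R̃, w̃, σ̃)`. -/
theorem gauss_schell_propagation_invariance
    (A w σ R d k : ℝ) (hA : 0 < A) (hw : 0 < w) (hσ : 0 < σ) (hR : 0 < R)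
    (hd : 0 < d) (hk : 0 < k)
    (ℓ δ ξ At Rt wt σt : ℝ)
    (hℓ : ℓ = Real.sqrt (d / (2 * k)))
    (hδ : δ = ℓ ^ 2 / R ^ 2)
    (hξ : ξ = ℓ ^ 2 / (w * σ * (1 + δ)))
    (hAt : At = A / ((1 + δ) * Real.sqrt (1 + ξ ^ 2)))
    (hRt : Rt = R * Real.sqrt ((1 + δ) * (1 + ξ ^ 2) / (1 + (1 + 1 / δ) * ξ ^ 2)))
    (hwt : wt = w * (1 + δ) * Real.sqrt (1 + ξ ^ 2))
    (hσt : σt = σ * (1 + δ) * Real.sqrt (1 + ξ ^ 2))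
    (y₁ y₂ : ℝ) :
    ((1 / (2 * Real.pi * ℓ ^ 2) : ℝ) : ℂ) *
        ∫ q : ℝ × ℝ, ((A : ℝ) : ℂ) * Complex.exp (Complex.I * (((q.1 * q.2) / R ^ 2 : ℝ) : ℂ)) *
          ((gaussN w q.1 : ℝ) : ℂ) * ((gaussN σ q.2 : ℝ) : ℂ) *
          Complex.exp (Complex.I * ((((y₁ - q.1) * (y₂ - q.2)) / ℓ ^ 2 : ℝ) : ℂ)) =
      ((At : ℝ) : ℂ) * Complex.exp (Complex.I * (((y₁ * y₂) / Rt ^ 2 : ℝ) : ℂ)) *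
        ((gaussN wt y₁ : ℝ) : ℂ) * ((gaussN σt y₂ : ℝ) : ℂ) := by
  have hℓ0 : 0 < ℓ := by rw [hℓ]; positivity
  have hδ0 : 0 < δ := by rw [hδ]; positivity
  have hS : Real.sqrt (1 + ξ ^ 2) ^ 2 = 1 + ξ ^ 2 := Real.sq_sqrt (by positivity)
  have hwt2 : wt ^ 2 = w ^ 2 * ((1 + δ) ^ 2 * (1 + ξ ^ 2)) := by
    rw [hwt, mul_pow, mul_pow, hS, mul_assoc]
  have hσt2 : σt ^ 2 = σ ^ 2 * ((1 + δ) ^ 2 * (1 + ξ ^ 2)) := by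
    rw [hσt, mul_pow, mul_pow, hS, mul_assoc]
  have hRt2 : Rt ^ 2 = R ^ 2 * ((1 + δ) * (1 + ξ ^ 2) / (1 + (1 + 1 / δ) * ξ ^ 2)) := by
    rw [hRt, mul_pow, Real.sq_sqrt (by positivity)]
  have hR2 : R ^ 2 = ℓ ^ 2 / δ := by rw [hδ]; field_simp
  have hD : 4 * (1 / (2 * w ^ 2)) * (1 / (2 * σ ^ 2)) + ((1 + δ) / ℓ ^ 2) ^ 2 =
      ((1 + δ) * Real.sqrt (1 + ξ ^ 2) / ℓ ^ 2) ^ 2 := by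
    rw [div_pow (_ * _), mul_pow, hS, hξ]
    field_simp
    ring
  have hD' : 4 * (1 / (2 * w ^ 2)) * (1 / (2 * σ ^ 2)) + ((1 + δ) / ℓ ^ 2) ^ 2 =
      (1 + δ) ^ 2 * (1 + ξ ^ 2) / ℓ ^ 4 := by
    rw [hD, div_pow, mul_pow, hS]
    ring
  have key := integral_cexp_gaussian_bilinear (a := 1 / (2 * w ^ 2)) (b := 1 / (2 * σ ^ 2))
    (by positivity) (by positivity) ((1 + δ) / ℓ ^ 2) (-y₂ / ℓ ^ 2) (-y₁ / ℓ ^ 2)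
  rw [hD, Real.sqrt_sq (by positivity)] at key
  have hint (q : ℝ × ℝ) :
      ((A : ℝ) : ℂ) * Complex.exp (Complex.I * (((q.1 * q.2) / R ^ 2 : ℝ) : ℂ)) *
          ((gaussN w q.1 : ℝ) : ℂ) * ((gaussN σ q.2 : ℝ) : ℂ) *
          Complex.exp (Complex.I * ((((y₁ - q.1) * (y₂ - q.2)) / ℓ ^ 2 : ℝ) : ℂ)) =
      (A : ℂ) * cexp (I * ((y₁ * y₂ / ℓ ^ 2 : ℝ) : ℂ)) *
        cexp (-((1 / (2 * w ^ 2) : ℝ) : ℂ) * (q.1 : ℂ) ^ 2 -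
          ((1 / (2 * σ ^ 2) : ℝ) : ℂ) * (q.2 : ℂ) ^ 2 +
          I * ((((1 + δ) / ℓ ^ 2 : ℝ) : ℂ) * q.1 * q.2 + ((-y₂ / ℓ ^ 2 : ℝ) : ℂ) * q.1 +
            ((-y₁ / ℓ ^ 2 : ℝ) : ℂ) * q.2)) := by
    rw [gaussN, gaussN, Complex.ofReal_exp, Complex.ofReal_exp, hR2]
    simp only [mul_assoc, ← Complex.exp_add]
    congr 2
    push_cast
    field_simp
    ring
  simp only [hint]
  rw [integral_const_mul, key, gaussN, gaussN, Complex.ofReal_exp, Complex.ofReal_exp,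
    hwt2, hσt2, hRt2, hR2, hAt]
  have hpre : 1 / (2 * Real.pi * ℓ ^ 2) *
      (A * (2 * Real.pi / ((1 + δ) * Real.sqrt (1 + ξ ^ 2) / ℓ ^ 2))) =
      A / ((1 + δ) * Real.sqrt (1 + ξ ^ 2)) := by
    field_simp
  rw [← hpre]
  have hDC := congrArg (fun r : ℝ => (r : ℂ)) hD'
  have hℓC : (ℓ : ℂ) ≠ 0 := by exact_mod_cast hℓ0.ne'
  have hδC' : (1 + δ : ℂ) ≠ 0 := by exact_mod_cast (by positivity : 1 + δ ≠ 0)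
  have hξC : (1 + ξ ^ 2 : ℂ) ≠ 0 := by exact_mod_cast (by positivity : 1 + ξ ^ 2 ≠ 0)
  have hexp : I * ((y₁ * y₂ / ℓ ^ 2 : ℝ) : ℂ) +
      -(((1 / (2 * σ ^ 2) : ℝ) : ℂ) * ((-y₂ / ℓ ^ 2 : ℝ) : ℂ) ^ 2 +
        ((1 / (2 * w ^ 2) : ℝ) : ℂ) * ((-y₁ / ℓ ^ 2 : ℝ) : ℂ) ^ 2 +
        I * (((1 + δ) / ℓ ^ 2 : ℝ) : ℂ) * ((-y₂ / ℓ ^ 2 : ℝ) : ℂ) * ((-y₁ / ℓ ^ 2 : ℝ) : ℂ)) /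
        (4 * ((1 / (2 * w ^ 2) : ℝ) : ℂ) * ((1 / (2 * σ ^ 2) : ℝ) : ℂ) +
          (((1 + δ) / ℓ ^ 2 : ℝ) : ℂ) ^ 2) =
      I * ((y₁ * y₂ / (ℓ ^ 2 / δ * ((1 + δ) * (1 + ξ ^ 2) / (1 + (1 + 1 / δ) * ξ ^ 2))) : ℝ) : ℂ) +
        (((-(y₁ ^ 2) / (2 * (w ^ 2 * ((1 + δ) ^ 2 * (1 + ξ ^ 2)))) : ℝ) : ℂ) +
          ((-(y₂ ^ 2) / (2 * (σ ^ 2 * ((1 + δ) ^ 2 * (1 + ξ ^ 2)))) : ℝ) : ℂ)) := by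
    have hphase : y₁ * y₂ / (ℓ ^ 2 / δ * ((1 + δ) * (1 + ξ ^ 2) / (1 + (1 + 1 / δ) * ξ ^ 2))) =
        y₁ * y₂ * (δ + (δ + 1) * ξ ^ 2) / (ℓ ^ 2 * ((1 + δ) * (1 + ξ ^ 2))) := by
      field_simp
    rw [hphase]
    push_cast at hDC ⊢
    rw [hDC]
    field_simp
    ring
  have hcexp := congrArg cexp hexp
  simp only [Complex.exp_add] at hcexp
  rw [Complex.ofReal_mul _ (A * _), Complex.ofReal_mul A]
  linear_combination ((1 / (2 * Real.pi * ℓ ^ 2) : ℝ) : ℂ) * ((A : ℂ) *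
    ((2 * Real.pi / ((1 + δ) * Real.sqrt (1 + ξ ^ 2) / ℓ ^ 2) : ℝ) : ℂ)) * hcexp
end

section
/- Let σ > 0 and u, ω ∈ ℝ. Then ∫_{−∞}^{u} exp(−iωx) N^{σ}(x) dx = √(π/2) · σ · [ N^{1/σ}(ω) + i · exp(−iωu) · (1/π) · p.v. ∫_{ℝ} exp(isu) N^{1/σ}(s)/(ω − s) ds ], where in particular the principal-value limit on the right-hand side exists. -/
open MeasureTheory Complex

theorem integral_exp_neg_mul_cos_Ioi {δ : ℝ} (hδ : 0 < δ) (y : ℝ) :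
    ∫ t in Set.Ioi (0 : ℝ), Real.exp (-δ * t) * Real.cos (t * y) = δ / (δ ^ 2 + y ^ 2) := by
  have ha : (⟨-δ, y⟩ : ℂ).re < 0 := by simpa using hδ
  have h := integral_exp_mul_complex_Ioi ha 0
  have hre := integral_re (𝕜 := ℂ) (integrableOn_exp_mul_complex_Ioi ha 0)
  rw [h] at hre
  calc
    _ = ∫ t in Set.Ioi (0 : ℝ), RCLike.re (Complex.exp ((⟨-δ, y⟩ : ℂ) * t)) := by
      congr 1 with t
      simp [Complex.exp_re, mul_comm y t]
    _ = _ := by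
      rw [hre]
      simp [Complex.neg_re, Complex.inv_re, Complex.normSq_apply, neg_div, pow_two]

theorem abs_sin_mul_div_le (t y : ℝ) : |Real.sin (t * y) / t| ≤ |y| := by
  rcases eq_or_ne t 0 with rfl | ht
  · simp
  · rw [abs_div, div_le_iff₀ (abs_pos.2 ht), ← abs_mul, mul_comm y]
    exact Real.abs_sin_le_abs

theorem integrableOn_exp_neg_mul_sin_div_Ioi {δ : ℝ} (hδ : 0 < δ) (y : ℝ) :
    IntegrableOn (fun t : ℝ => Real.exp (-δ * t) * (Real.sin (t * y) / t)) (Set.Ioi 0) := by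
  refine ((integrableOn_exp_mul_Ioi (neg_lt_zero.2 hδ) 0).mul_const |y|).mono'
    (by fun_prop) (.of_forall fun t => ?_)
  rw [norm_mul, Real.norm_eq_abs, Real.abs_exp]
  exact mul_le_mul_of_nonneg_left (abs_sin_mul_div_le t y) (Real.exp_nonneg _)

theorem integral_exp_neg_mul_sin_div_Ioi {δ : ℝ} (hδ : 0 < δ) (y : ℝ) :
    ∫ t in Set.Ioi (0 : ℝ), Real.exp (-δ * t) * (Real.sin (t * y) / t) = Real.arctan (y / δ) := by
  have hF (y : ℝ) : HasDerivAt
      (fun y => ∫ t in Set.Ioi (0 : ℝ), Real.exp (-δ * t) * (Real.sin (t * y) / t))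
      (δ / (δ ^ 2 + y ^ 2)) y := by
    rw [← integral_exp_neg_mul_cos_Ioi hδ]
    refine (hasDerivAt_integral_of_dominated_loc_of_deriv_le
      (F' := fun y t => Real.exp (-δ * t) * Real.cos (t * y))
      (bound := fun t => Real.exp (-δ * t)) Filter.univ_mem
      (.of_forall fun y => (integrableOn_exp_neg_mul_sin_div_Ioi hδ y).aestronglyMeasurable)
      (integrableOn_exp_neg_mul_sin_div_Ioi hδ y) (by fun_prop)
      (.of_forall fun t y _ => ?_) (integrableOn_exp_mul_Ioi (neg_lt_zero.2 hδ) 0) ?_).2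
    · rw [norm_mul, Real.norm_eq_abs, Real.abs_exp]
      exact mul_le_of_le_one_right (Real.exp_nonneg _) (Real.abs_cos_le_one _)
    · filter_upwards [ae_restrict_mem measurableSet_Ioi] with t ht y _
      have ht' : t ≠ 0 := (Set.mem_Ioi.1 ht).ne'
      have h := ((((hasDerivAt_id y).const_mul t).sin).div_const t).const_mul (Real.exp (-δ * t))
      simp only [id_eq, mul_one, mul_div_cancel_right₀ _ ht'] at h
      exact h
  have hA (y : ℝ) : HasDerivAt (fun y => Real.arctan (y / δ)) (δ / (δ ^ 2 + y ^ 2)) y := by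
    have h := ((hasDerivAt_id y).div_const δ).arctan
    simp only [id_eq] at h
    convert h using 1
    field_simp
  have hc := is_const_of_deriv_eq_zero (fun y => ((hF y).sub (hA y)).differentiableAt)
    (fun y => by rw [((hF y).sub (hA y)).deriv, sub_self]) y 0
  simp only [Pi.sub_apply, mul_zero, Real.sin_zero, zero_div, integral_zero, Real.arctan_zero,
    sub_zero] at hc
  exact sub_eq_zero.1 hc

theorem tendsto_arctan_div_nhdsGT_zero {x : ℝ} (hx : x ≠ 0) :
    Filter.Tendsto (fun δ : ℝ => Real.arctan (x / δ)) (nhdsWithin 0 (Set.Ioi 0))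
      (nhds (if 0 < x then Real.pi / 2 else -(Real.pi / 2))) := by
  rcases hx.lt_or_gt with h | h
  · simpa [Function.comp_def, h.not_gt, div_eq_mul_inv] using
      (Real.tendsto_arctan_atBot.mono_right nhdsWithin_le_nhds).comp
        (tendsto_inv_nhdsGT_zero.const_mul_atTop_of_neg h)
  · simpa [Function.comp_def, h, div_eq_mul_inv] using
      (Real.tendsto_arctan_atTop.mono_right nhdsWithin_le_nhds).comp
        (tendsto_inv_nhdsGT_zero.const_mul_atTop h)

/-- An odd function built from an integrable `h` that is differentiable at the origin may be
divided by its argument without losing integrability. -/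
theorem integrableOn_sub_comp_neg_div {h : ℝ → ℂ} (hi : Integrable h) (hc : Continuous h)
    (hd : DifferentiableAt ℝ h 0) :
    IntegrableOn (fun t : ℝ => (h t - h (-t)) / t) (Set.Ioi 0) := by
  let k : ℝ → ℂ := fun t => h t - h (-t)
  have hkc : Continuous k := by fun_prop
  have hkd : DifferentiableAt ℝ k 0 :=
    hd.sub (DifferentiableAt.comp (0 : ℝ) (by simpa using hd) differentiable_neg.differentiableAt)
  rw [← Set.Ioc_union_Ioi_eq_Ioi zero_le_one]
  refine IntegrableOn.union ?_ ?_
  · have hs : ContinuousOn (dslope k 0) (Set.Icc 0 1) :=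
      ((continuousOn_dslope Filter.univ_mem).2 ⟨hkc.continuousOn, hkd⟩).mono (Set.subset_univ _)
    refine (hs.integrableOn_Icc.mono_set Set.Ioc_subset_Icc_self).congr_fun (fun t ht => ?_)
      measurableSet_Ioc
    rw [dslope_of_ne _ ht.1.ne', slope_def_module]
    simp [k, div_eq_inv_mul]
  · refine (hi.sub hi.comp_neg).norm.integrableOn.mono' ?_ ?_
    · exact (Measurable.aestronglyMeasurable (by fun_prop))
    · filter_upwards [ae_restrict_mem measurableSet_Ioi] with t ht
      have ht1 : (1 : ℝ) < t := ht
      rw [norm_div, norm_real, Real.norm_eq_abs, abs_of_pos (by linarith)]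
      exact div_le_self (norm_nonneg _) ht1.le

theorem tendsto_setIntegral_div_principalValue {h : ℝ → ℂ} (hi : Integrable h) (hc : Continuous h)
    (hd : DifferentiableAt ℝ h 0) :
    Filter.Tendsto (fun ε : ℝ => ∫ t in {t : ℝ | ε < |t|}, h t / t)
      (nhdsWithin 0 (Set.Ioi 0)) (nhds (∫ t in Set.Ioi (0 : ℝ), (h t - h (-t)) / t)) := by
  have hlim := (aecover_Ioi_of_Ioi (μ := volume) (A := (0 : ℝ))
    (Filter.tendsto_id.mono_left (nhdsWithin_le_nhds (s := Set.Ioi 0))))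
      |>.integral_tendsto_of_countably_generated (integrableOn_sub_comp_neg_div hi hc hd)
  refine hlim.congr' ?_
  filter_upwards [self_mem_nhdsWithin] with ε hε
  have hε : 0 < ε := hε
  have hset : {t : ℝ | ε < |t|} = Set.Iio (-ε) ∪ Set.Ioi ε := by
    ext t
    simp only [Set.mem_ofPred_eq, lt_abs, Set.mem_union, Set.mem_Iio, Set.mem_Ioi]
    constructor <;> rintro (h | h) <;> first | (left; linarith) | (right; linarith)
  have hint : IntegrableOn (fun t : ℝ => h t / t) {t : ℝ | ε < |t|} := by
    refine (hi.norm.div_const ε).integrableOn.mono'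
      (Measurable.aestronglyMeasurable (by fun_prop)) ?_
    filter_upwards [ae_restrict_mem (measurableSet_lt measurable_const (by fun_prop))] with t ht
    rw [norm_div, norm_real, Real.norm_eq_abs]
    exact div_le_div_of_nonneg_left (norm_nonneg _) hε (le_of_lt ht)
  rw [hset, integrableOn_union] at hint
  have hneg : IntegrableOn (fun t : ℝ => h (-t) / ((-t : ℝ) : ℂ)) (Set.Ioi ε) := by
    have h := (Measure.measurePreserving_neg (volume : Measure ℝ)).integrableOn_comp_preimage
      (Homeomorph.neg ℝ).measurableEmbedding (s := Set.Iio (-ε)) (f := fun t : ℝ => h t / t)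
    simpa [Function.comp_def] using h.2 hint.1
  rw [id_eq, Measure.restrict_restrict measurableSet_Ioi,
    Set.inter_eq_left.2 (Set.Ioi_subset_Ioi hε.le), hset,
    setIntegral_union (Set.Iio_disjoint_Ioi_of_le (by linarith)) measurableSet_Ioi hint.1 hint.2,
    ← integral_Iic_eq_integral_Iio, ← integral_comp_neg_Ioi, ← integral_add hneg hint.2]
  refine integral_congr_ae (.of_forall fun t => ?_)
  simp only [ofReal_neg, div_neg]
  ring

/-- Dirichlet's integral in weak form: the damped kernel `exp (-δ t) sin (t x) / t` integrates to
`arctan (x / δ)`, which is bounded and tends to `π / 2` or `-π / 2` according to the sign of `x`. -/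
theorem integral_fourier_sub_comp_neg_div {w h : ℝ → ℂ} (hw : Integrable w)
    (hxw : Integrable fun x : ℝ => |x| * ‖w x‖)
    (hh : ∀ t : ℝ, h t = ∫ x : ℝ, cexp (I * ((t * x : ℝ) : ℂ)) * w x)
    (hi : IntegrableOn (fun t : ℝ => (h t - h (-t)) / t) (Set.Ioi 0)) :
    ∫ t in Set.Ioi (0 : ℝ), (h t - h (-t)) / t =
      I * Real.pi * ((∫ x in Set.Ioi 0, w x) - ∫ x in Set.Iic 0, w x) := by
  have hexp (t : ℝ) : Integrable fun x : ℝ => cexp (I * ((t * x : ℝ) : ℂ)) * w x := by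
    refine hw.norm.mono' (by fun_prop) (.of_forall fun x => ?_)
    rw [norm_mul, mul_comm I, norm_exp_ofReal_mul_I, one_mul]
  have hsin (t : ℝ) : (h t - h (-t)) / t =
      ∫ x : ℝ, 2 * I * (((Real.sin (t * x) / t : ℝ) : ℂ) * w x) := by
    rw [hh, hh, ← integral_sub (hexp t) (hexp (-t)), ← integral_div]
    congr 1 with x
    rw [neg_mul, ofReal_neg, mul_comm I, mul_comm I, ofReal_div, ofReal_sin]
    linear_combination (-(w x) * I / t) * Complex.two_sin ((t * x : ℝ) : ℂ) +
      (w x / t) * (cexp (((t * x : ℝ) : ℂ) * I) - cexp (-((t * x : ℝ) : ℂ) * I)) * I_mul_I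
  have hdamp {δ : ℝ} (hδ : 0 < δ) :
      ∫ t in Set.Ioi (0 : ℝ), (Real.exp (-δ * t) : ℂ) * ((h t - h (-t)) / t) =
        ∫ x : ℝ, 2 * I * ((Real.arctan (x / δ) : ℂ) * w x) := by
    calc
      _ = ∫ t in Set.Ioi (0 : ℝ), ∫ x : ℝ,
            2 * I * (((Real.exp (-δ * t) * (Real.sin (t * x) / t) : ℝ) : ℂ) * w x) := by
        congr 1 with t
        rw [hsin, ← integral_const_mul]
        congr 1 with x
        push_cast
        ring
      _ = ∫ x : ℝ, ∫ t in Set.Ioi (0 : ℝ),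
            2 * I * (((Real.exp (-δ * t) * (Real.sin (t * x) / t) : ℝ) : ℂ) * w x) := by
        refine integral_integral_swap ?_
        refine (((integrableOn_exp_mul_Ioi (neg_lt_zero.2 hδ) 0).mul_prod hxw).const_mul 2).mono'
          ?_ (.of_forall fun p => ?_)
        · refine AEStronglyMeasurable.const_mul (.mul ?_ hw.aestronglyMeasurable.comp_snd) _
          exact Measurable.aestronglyMeasurable (by fun_prop)
        · simp only [Function.uncurry, norm_mul, norm_real, Real.norm_eq_abs, Real.abs_exp,
            Complex.norm_two, norm_I, mul_one]
          rw [mul_assoc (Real.exp _)]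
          gcongr 2 * (_ * (?_ * _))
          exact abs_sin_mul_div_le _ _
      _ = _ := by
        congr 1 with x
        rw [integral_const_mul, integral_mul_const, integral_complex_ofReal,
          integral_exp_neg_mul_sin_div_Ioi hδ]
  have hlim₁ : Filter.Tendsto
      (fun δ : ℝ => ∫ t in Set.Ioi (0 : ℝ), (Real.exp (-δ * t) : ℂ) * ((h t - h (-t)) / t))
      (nhdsWithin 0 (Set.Ioi 0)) (nhds (∫ t in Set.Ioi (0 : ℝ), (h t - h (-t)) / t)) := by
    refine tendsto_integral_filter_of_dominated_convergence _
      (.of_forall fun δ => .mul (by fun_prop) hi.aestronglyMeasurable) ?_ hi.norm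
      (.of_forall fun t => ?_)
    · filter_upwards [self_mem_nhdsWithin] with δ hδ
      filter_upwards [ae_restrict_mem measurableSet_Ioi] with t ht
      rw [norm_mul, norm_real, Real.norm_eq_abs, Real.abs_exp]
      refine mul_le_of_le_one_left (norm_nonneg _) (Real.exp_le_one_iff.2 ?_)
      rw [neg_mul]
      exact neg_nonpos.2 (mul_pos hδ ht).le
    · have hc : Continuous fun δ : ℝ => (Real.exp (-δ * t) : ℂ) * ((h t - h (-t)) / t) := by
        fun_prop
      simpa using (hc.tendsto 0).mono_left nhdsWithin_le_nhds
  have hlim₂ : Filter.Tendsto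
      (fun δ : ℝ => ∫ x : ℝ, 2 * I * ((Real.arctan (x / δ) : ℂ) * w x))
      (nhdsWithin 0 (Set.Ioi 0))
      (nhds (∫ x : ℝ, 2 * I * (((if 0 < x then Real.pi / 2 else -(Real.pi / 2) : ℝ) : ℂ) * w x))) := by
    refine tendsto_integral_filter_of_dominated_convergence (fun x => 2 * (Real.pi / 2 * ‖w x‖))
      (.of_forall fun δ => ?_) (.of_forall fun δ => .of_forall fun x => ?_)
      ((hw.norm.const_mul _).const_mul _) ?_
    · refine AEStronglyMeasurable.const_mul (.mul ?_ hw.aestronglyMeasurable) _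
      exact Measurable.aestronglyMeasurable (by fun_prop)
    · simp only [norm_mul, norm_real, Real.norm_eq_abs, Complex.norm_two, norm_I, mul_one]
      gcongr
      exact abs_le.2 ⟨(Real.neg_pi_div_two_lt_arctan _).le, (Real.arctan_lt_pi_div_two _).le⟩
    · filter_upwards [compl_mem_ae_iff.2 (measure_singleton (0 : ℝ))] with x hx
      exact (((continuous_ofReal.tendsto _).comp
        (tendsto_arctan_div_nhdsGT_zero hx)).mul_const _).const_mul _
  have hsgn : Integrable fun x : ℝ =>
      2 * I * (((if 0 < x then Real.pi / 2 else -(Real.pi / 2) : ℝ) : ℂ) * w x) := by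
    refine ((hw.norm.const_mul (Real.pi / 2)).const_mul 2).mono' ?_ (.of_forall fun x => ?_)
    · refine AEStronglyMeasurable.const_mul (.mul ?_ hw.aestronglyMeasurable) _
      exact (measurable_ofReal.comp
        (measurable_const.ite measurableSet_Ioi measurable_const)).aestronglyMeasurable
    · split_ifs <;> simp [abs_of_pos Real.pi_pos]
  rw [tendsto_nhds_unique hlim₁ (hlim₂.congr' (by
      filter_upwards [self_mem_nhdsWithin] with δ hδ using (hdamp hδ).symm)),
    ← integral_add_compl (measurableSet_Ioi (a := (0 : ℝ))) hsgn, Set.compl_Ioi,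
    integral_Iic_eq_integral_Iio, integral_Iic_eq_integral_Iio, mul_sub, sub_eq_add_neg,
    ← integral_const_mul, ← integral_const_mul, ← integral_neg]
  congr 1
  · refine setIntegral_congr_fun measurableSet_Ioi fun x hx => ?_
    simp only [if_pos (Set.mem_Ioi.1 hx)]
    push_cast
    ring
  · refine setIntegral_congr_fun measurableSet_Iio fun x hx => ?_
    simp only [if_neg (Set.mem_Iio.1 hx).not_gt]
    push_cast
    ring

theorem integral_cexp_mul_gaussN {σ : ℝ} (hσ : 0 < σ) (s : ℝ) :
    ∫ x : ℝ, cexp (I * ((s * x : ℝ) : ℂ)) * (gaussN σ x : ℂ) =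
      ((2 * Real.sqrt (Real.pi / 2) * σ : ℝ) : ℂ) * (gaussN (1 / σ) s : ℂ) := by
  have hb : 0 < (((1 / (2 * σ ^ 2) : ℝ)) : ℂ).re := by rw [ofReal_re]; positivity
  have hconst : (2 * Real.sqrt (Real.pi / 2) * σ) = (Real.pi / (1 / (2 * σ ^ 2))) ^ (1 / 2 : ℝ) := by
    rw [← Real.sqrt_eq_rpow, eq_comm, Real.sqrt_eq_iff_mul_self_eq (by positivity) (by positivity)]
    have := Real.mul_self_sqrt (show 0 ≤ Real.pi / 2 by positivity)
    rw [div_div_eq_mul_div, div_one]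
    linear_combination (-4 * σ ^ 2) * this
  have hsq : ((Real.pi / (1 / (2 * σ ^ 2)) : ℝ) : ℂ) ^ (1 / 2 : ℂ) =
      ((2 * Real.sqrt (Real.pi / 2) * σ : ℝ) : ℂ) := by
    rw [hconst, ofReal_cpow (by positivity)]
    norm_num
  have h := fourierIntegral_gaussian hb (s : ℂ)
  rw [← ofReal_div, hsq] at h
  convert h using 1
  · congr 1 with x
    rw [gaussN, ofReal_exp, ofReal_mul, mul_assoc]
    congr 2
    push_cast
    field_simp
  · rw [gaussN, ofReal_exp]
    congr 2
    push_cast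
    field_simp
    ring

theorem gaussN_eq_exp_neg_mul_sq (β x : ℝ) : gaussN β x = Real.exp (-(1 / (2 * β ^ 2)) * x ^ 2) := by
  rw [gaussN]
  congr 1
  ring

theorem contDiff_gaussN (β : ℝ) : ContDiff ℝ 1 (gaussN β) := by
  unfold gaussN
  fun_prop

theorem integrable_mul_gaussN {β : ℝ} (hβ : 0 < β) : Integrable fun x => x * gaussN β x := by
  simp_rw [gaussN_eq_exp_neg_mul_sq β]
  exact integrable_mul_exp_neg_mul_sq (by positivity)

theorem gaussN_nonneg (β x : ℝ) : 0 ≤ gaussN β x := Real.exp_nonneg _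

/-- Exact formula for the Fourier transform of a truncated Gaussian in terms of the
conjugated Hilbert transform: `Φ^σ(ω,u) = √(π/2) σ [(I + i H^u) N^{1/σ}](ω)`, where the
principal-value limit `P` defining the Hilbert transform exists. -/
theorem truncated_gaussian_fourier_conjugated_hilbert
    (σ u ω : ℝ) (hσ : 0 < σ) :
    ∃ P : ℂ,
      Filter.Tendsto (fun ε : ℝ =>
          ∫ s in {s : ℝ | ε < |ω - s|},
            Complex.exp (Complex.I * ((s * u : ℝ) : ℂ)) * ((gaussN (1 / σ) s : ℝ) : ℂ) /
              (((ω : ℝ) : ℂ) - ((s : ℝ) : ℂ)))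
        (nhdsWithin (0 : ℝ) (Set.Ioi 0)) (nhds P) ∧
      (∫ x in Set.Iic u, Complex.exp (-Complex.I * ((ω * x : ℝ) : ℂ)) * ((gaussN σ x : ℝ) : ℂ)) =
        ((Real.sqrt (Real.pi / 2) * σ : ℝ) : ℂ) *
          (((gaussN (1 / σ) ω : ℝ) : ℂ) +
            Complex.I * Complex.exp (-Complex.I * ((ω * u : ℝ) : ℂ)) *
              ((1 / Real.pi : ℝ) : ℂ) * P) := by
  set C : ℝ := 2 * Real.sqrt (Real.pi / 2) * σ with hC
  have hC0 : (C : ℂ) ≠ 0 := by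
    rw [ofReal_ne_zero]
    positivity
  let h : ℝ → ℂ := fun t => cexp (I * (((ω - t) * u : ℝ) : ℂ)) * (gaussN (1 / σ) (ω - t) : ℂ)
  let w : ℝ → ℂ := fun x => (C : ℂ)⁻¹ * (cexp (-I * ((ω * x : ℝ) : ℂ)) * (gaussN σ (x + u) : ℂ))
  have hhd : Differentiable ℝ h := by
    have := (contDiff_gaussN (1 / σ)).differentiable one_ne_zero
    have hg : Differentiable ℝ fun t : ℝ => (gaussN (1 / σ) (ω - t) : ℂ) :=
      ofRealCLM.differentiable.comp (this.comp (by fun_prop))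
    have he : Differentiable ℝ fun t : ℝ => (((ω - t) * u : ℝ) : ℂ) :=
      ofRealCLM.differentiable.comp
        (((differentiable_const ω).sub differentiable_id).mul_const u)
    exact (he.const_mul I).cexp.mul hg
  have hhi : Integrable h := by
    refine ((integrable_gaussN (one_div_pos.2 hσ)).comp_sub_left ω).mono'
      hhd.continuous.aestronglyMeasurable (.of_forall fun t => ?_)
    rw [norm_mul, mul_comm I, norm_exp_ofReal_mul_I, one_mul, norm_real, Real.norm_of_nonneg
      (gaussN_nonneg _ _)]
  have hnw (x : ℝ) : ‖w x‖ = ‖(C : ℂ)⁻¹‖ * gaussN σ (x + u) := by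
    rw [norm_mul, norm_mul, neg_mul, mul_comm I, ← neg_mul, ← ofReal_neg, norm_exp_ofReal_mul_I,
      one_mul, norm_real, Real.norm_of_nonneg (gaussN_nonneg _ _)]
  have hgc := (contDiff_gaussN σ).continuous
  have hwc : Continuous w := by fun_prop
  have hgi := (integrable_gaussN hσ).comp_add_right u
  have hwi : Integrable w :=
    (hgi.const_mul ‖(C : ℂ)⁻¹‖).mono' hwc.aestronglyMeasurable (.of_forall fun x => (hnw x).le)
  have hxw : Integrable fun x : ℝ => |x| * ‖w x‖ := by
    refine ((((integrable_mul_gaussN hσ).comp_add_right u).sub (hgi.const_mul u)).norm.const_mul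
      ‖(C : ℂ)⁻¹‖).congr (.of_forall fun x => ?_)
    simp only [Pi.sub_apply]
    rw [hnw, ← sub_mul, add_sub_cancel_right, norm_mul, Real.norm_of_nonneg (gaussN_nonneg _ _),
      Real.norm_eq_abs]
    ring
  have hh (t : ℝ) : h t = ∫ x : ℝ, cexp (I * ((t * x : ℝ) : ℂ)) * w x := by
    have hF := integral_cexp_mul_gaussN hσ (t - ω)
    rw [← integral_add_right_eq_self _ u] at hF
    calc
      h t = cexp (I * (((ω - t) * u : ℝ) : ℂ)) * (C : ℂ)⁻¹ * (C * (gaussN (1 / σ) (t - ω) : ℂ)) := by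
        have : gaussN (1 / σ) (t - ω) = gaussN (1 / σ) (ω - t) := by
          rw [gaussN, gaussN, sub_sq_comm]
        rw [this, mul_assoc, inv_mul_cancel_left₀ hC0]
      _ = _ := by
        rw [← hF, ← integral_const_mul]
        congr 1 with x
        have : cexp (I * ((t * x : ℝ) : ℂ)) * cexp (-I * ((ω * x : ℝ) : ℂ)) =
            cexp (I * (((ω - t) * u : ℝ) : ℂ)) * cexp (I * (((t - ω) * (x + u) : ℝ) : ℂ)) := by
          rw [← Complex.exp_add, ← Complex.exp_add]
          congr 1
          push_cast
          ring
        linear_combination (-(C : ℂ)⁻¹ * gaussN σ (x + u)) * this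
  have hint : ∫ x in Set.Iic 0, w x = (C : ℂ)⁻¹ * cexp (I * ((ω * u : ℝ) : ℂ)) *
      ∫ x in Set.Iic u, cexp (-I * ((ω * x : ℝ) : ℂ)) * (gaussN σ x : ℂ) := by
    rw [← (measurePreserving_add_right volume u).setIntegral_preimage_emb
      (measurableEmbedding_addRight u) _ (Set.Iic u), Set.preimage_add_const_Iic, sub_self,
      ← integral_const_mul]
    congr 1 with x
    have : cexp (-I * ((ω * x : ℝ) : ℂ)) =
        cexp (I * ((ω * u : ℝ) : ℂ)) * cexp (-I * ((ω * (x + u) : ℝ) : ℂ)) := by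
      rw [← Complex.exp_add]
      congr 1
      push_cast
      ring
    linear_combination ((C : ℂ)⁻¹ * gaussN σ (x + u)) * this
  have htotal : h 0 = (∫ x in Set.Iic 0, w x) + ∫ x in Set.Ioi 0, w x := by
    rw [intervalIntegral.integral_Iic_add_Ioi hwi.integrableOn hwi.integrableOn, hh]
    simp
  refine ⟨∫ t in Set.Ioi (0 : ℝ), (h t - h (-t)) / t, ?_, ?_⟩
  · refine (tendsto_setIntegral_div_principalValue hhi hhd.continuous (hhd 0)).congr fun ε => ?_
    rw [← (Measure.measurePreserving_sub_left volume ω).setIntegral_preimage_emb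
      (measurableEmbedding_subLeft ω)]
    simp [h]
  · rw [integral_fourier_sub_comp_neg_div hwi hxw hh
      (integrableOn_sub_comp_neg_div hhi hhd.continuous (hhd 0)), eq_sub_of_add_eq' htotal.symm,
      hint]
    set L := ∫ x in Set.Iic u, cexp (-I * ((ω * x : ℝ) : ℂ)) * (gaussN σ x : ℂ)
    have hE : cexp (-I * ((ω * u : ℝ) : ℂ)) * cexp (I * ((ω * u : ℝ) : ℂ)) = 1 := by
      rw [← Complex.exp_add, neg_mul, neg_add_cancel, Complex.exp_zero]
    have hπ : ((1 / Real.pi : ℝ) : ℂ) * Real.pi = 1 := by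
      rw [← ofReal_mul, one_div_mul_cancel Real.pi_ne_zero, ofReal_one]
    have hA : ((Real.sqrt (Real.pi / 2) * σ : ℝ) : ℂ) = C / 2 := by
      rw [hC]
      push_cast
      ring
    have h0 : h 0 = cexp (I * ((ω * u : ℝ) : ℂ)) * (gaussN (1 / σ) ω : ℂ) := by simp [h]
    rw [hA, h0]
    generalize cexp (-I * ((ω * u : ℝ) : ℂ)) = E' at *
    generalize cexp (I * ((ω * u : ℝ) : ℂ)) = E at *
    generalize (gaussN (1 / σ) ω : ℂ) = N at *
    calc
      L = C / 2 * (N - 1 * 1 * (N - 2 * ((C : ℂ)⁻¹ * L))) := by field_simp; ring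
      _ = C / 2 * (N + I * I * (E' * E) * (((1 / Real.pi : ℝ) : ℂ) * Real.pi) *
            (N - 2 * ((C : ℂ)⁻¹ * L))) := by rw [hE, hπ, I_mul_I]; ring
      _ = _ := by ring
end

section
/- Let σ > 0 and u, v, ω ∈ ℝ. Then ∫_{v}^{u} exp(−iωx) N^{σ}(x) dx = √(π/2) · σ · i · [ exp(−iωu) · (1/π) · p.v. ∫_{ℝ} exp(isu) N^{1/σ}(s)/(ω − s) ds − exp(−iωv) · (1/π) · p.v. ∫_{ℝ} exp(isv) N^{1/σ}(s)/(ω − s) ds ], both principal-value limits existing. -/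
open MeasureTheory Complex

open Set Filter Topology

theorem integrable_div_of_differentiableAt_zero {f : ℝ → ℂ} (hc : Continuous f)
    (hi : Integrable f) (hd : DifferentiableAt ℝ f 0) (h0 : f 0 = 0) :
    Integrable (fun t : ℝ => f t / (t : ℂ)) := by
  have hds : Continuous (dslope f 0) := by
    rw [← continuousOn_univ, continuousOn_dslope univ_mem]
    exact ⟨hc.continuousOn, hd⟩
  have hnear : IntegrableOn (dslope f 0) (Icc (-1) 1) := hds.continuousOn.integrableOn_Icc
  have hfar : IntegrableOn (dslope f 0) (Icc (-1) 1)ᶜ := by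
    refine Integrable.mono (hi.integrableOn (s := (Icc (-1) 1)ᶜ)) hds.aestronglyMeasurable ?_
    filter_upwards [ae_restrict_mem measurableSet_Icc.compl] with t ht
    have ht1 : 1 ≤ |t| := by
      by_contra! h
      exact ht (abs_le.1 h.le)
    have htne : t ≠ 0 := by
      rintro rfl
      norm_num at ht1
    rw [dslope_of_ne _ htne, slope_def_module, h0, sub_zero, sub_zero, norm_smul, norm_inv,
      Real.norm_eq_abs]
    exact mul_le_of_le_one_left (norm_nonneg _) (inv_le_one_of_one_le₀ ht1)
  have h : Integrable (dslope f 0) := by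
    rw [← integrableOn_univ, ← union_compl_self (Icc (-1 : ℝ) 1)]
    exact hnear.union hfar
  refine h.congr ?_
  filter_upwards [compl_mem_ae_iff.2 (measure_singleton (0 : ℝ))] with t ht
  rw [dslope_of_ne _ ht, slope_def_module, h0, sub_zero, sub_zero, real_smul, ofReal_inv,
    div_eq_inv_mul]

theorem setIntegral_lt_abs_eq_zero_of_odd {f : ℝ → ℂ} (hf : ∀ t, f (-t) = -f t) (ε : ℝ) :
    ∫ t in {t : ℝ | ε < |t|}, f t = 0 := by
  have hm : MeasurableSet {t : ℝ | ε < |t|} := measurableSet_lt measurable_const measurable_norm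
  rw [← integral_indicator hm]
  have h := integral_neg_eq_self ({t : ℝ | ε < |t|}.indicator f) volume
  have h' : ∀ t, {t : ℝ | ε < |t|}.indicator f (-t) = -{t : ℝ | ε < |t|}.indicator f t := by
    intro t
    by_cases ht : ε < |t| <;> simp [indicator, ht, hf]
  simp_rw [h', integral_neg] at h
  exact CharZero.neg_eq_self_iff.1 h

theorem tendsto_setIntegral_lt_abs {f : ℝ → ℂ} (hf : Integrable f) :
    Tendsto (fun ε : ℝ => ∫ t in {t : ℝ | ε < |t|}, f t) (𝓝[>] 0) (𝓝 (∫ t, f t)) := by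
  have hm (ε : ℝ) : MeasurableSet {t : ℝ | ε < |t|} :=
    measurableSet_lt measurable_const measurable_norm
  simp_rw [← integral_indicator (hm _)]
  refine tendsto_integral_filter_of_dominated_convergence (fun t => ‖f t‖)
    (.of_forall fun ε => hf.aestronglyMeasurable.indicator (hm ε))
    (.of_forall fun ε => .of_forall fun t => norm_indicator_le_norm_self _ _) hf.norm ?_
  filter_upwards [compl_mem_ae_iff.2 (measure_singleton (0 : ℝ))] with t ht
  refine tendsto_const_nhds.congr' ?_
  filter_upwards [Ioo_mem_nhdsGT (abs_pos.2 ht)] with ε hε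
  exact (indicator_of_mem (s := {t : ℝ | ε < |t|}) hε.2 f).symm

/-- The integrand of the principal value of `f t / t` at `0`, regularized by an even Gaussian. -/
noncomputable def regularizedDiv (f : ℝ → ℂ) (t : ℝ) : ℂ :=
  (f t - f 0 * cexp (-1 * (t : ℂ) ^ 2)) / t

theorem integrable_regularizedDiv {f : ℝ → ℂ} (hc : Continuous f)
    (hi : Integrable f) (hd : DifferentiableAt ℝ f 0) : Integrable (regularizedDiv f) := by
  have hofReal : DifferentiableAt ℝ (fun t : ℝ => (t : ℂ)) 0 := ofRealCLM.differentiableAt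
  refine integrable_div_of_differentiableAt_zero (f := fun t => f t - f 0 * cexp (-1 * (t : ℂ) ^ 2))
    (by fun_prop) (hi.sub ((integrable_cexp_neg_mul_sq (by simp)).const_mul _)) ?_ (by simp)
  exact hd.sub ((((hofReal.pow 2).const_mul (-1)).cexp).const_mul _)

theorem tendsto_setIntegral_div_of_differentiableAt_zero {f : ℝ → ℂ} (hc : Continuous f)
    (hi : Integrable f) (hd : DifferentiableAt ℝ f 0) :
    Tendsto (fun ε : ℝ => ∫ t in {t : ℝ | ε < |t|}, f t / (t : ℂ)) (𝓝[>] 0)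
      (𝓝 (∫ t, regularizedDiv f t)) := by
  have hr := integrable_regularizedDiv hc hi hd
  refine (tendsto_setIntegral_lt_abs hr).congr' ?_
  filter_upwards [self_mem_nhdsWithin] with ε (hε : 0 < ε)
  have hm : MeasurableSet {t : ℝ | ε < |t|} := measurableSet_lt measurable_const measurable_norm
  have hg : IntegrableOn (fun t : ℝ => f 0 * cexp (-1 * (t : ℂ) ^ 2) / t) {t : ℝ | ε < |t|} := by
    have h1 : Integrable fun t : ℝ => ε⁻¹ • (f 0 * cexp (-1 * (t : ℂ) ^ 2)) :=
      ((integrable_cexp_neg_mul_sq (by simp)).const_mul _).smul ε⁻¹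
    refine Integrable.mono (h1.integrableOn (s := {t : ℝ | ε < |t|}))
      (Measurable.aestronglyMeasurable (by fun_prop)) ?_
    filter_upwards [ae_restrict_mem hm] with t ht
    rw [norm_div, norm_smul, norm_inv, Real.norm_of_nonneg hε.le, norm_real, Real.norm_eq_abs,
      div_eq_inv_mul]
    gcongr
  have hsplit : ∀ t : ℝ,
      f t / (t : ℂ) = regularizedDiv f t + f 0 * cexp (-1 * (t : ℂ) ^ 2) / t := by
    intro t
    rw [regularizedDiv]
    ring
  simp_rw [hsplit]
  rw [integral_add hr.integrableOn hg, setIntegral_lt_abs_eq_zero_of_odd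
    (f := fun t : ℝ => f 0 * cexp (-1 * (t : ℂ) ^ 2) / t) (fun t => by simp [div_neg]), add_zero]

theorem integral_exp_sub_exp_mul_div {g : ℝ → ℂ} (hg : Integrable g) (u v : ℝ) :
    ∫ t : ℝ, (cexp (-I * (t * u : ℝ)) * g t - cexp (-I * (t * v : ℝ)) * g t) / (t : ℂ) =
      ∫ x in v..u, -I * ∫ t : ℝ, cexp (-I * (t * x : ℝ)) * g t := by
  have hprod : Integrable (Function.uncurry fun (x t : ℝ) => -I * (cexp (-I * (t * x : ℝ)) * g t))
      ((volume.restrict (uIoc v u)).prod volume) := by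
    have h1 : Integrable (fun _ : ℝ => (1 : ℂ)) (volume.restrict (uIoc v u)) :=
      integrableOn_const (by simp [uIoc])
    refine (h1.mul_prod hg).mono ?_ (.of_forall fun p => ?_)
    · have h2 : AEStronglyMeasurable (fun p : ℝ × ℝ => g p.2)
          ((volume.restrict (uIoc v u)).prod volume) := hg.aestronglyMeasurable.comp_snd
      exact (Continuous.aestronglyMeasurable (by fun_prop)).mul
        ((Continuous.aestronglyMeasurable (by fun_prop)).mul h2)
    · have : ‖cexp (-I * (p.2 * p.1 : ℝ))‖ = 1 := by
        rw [norm_exp]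
        simp
      simp only [Function.uncurry, norm_mul, norm_neg, norm_I, this, one_mul, le_refl]
  simp_rw [← integral_const_mul]
  rw [intervalIntegral_integral_swap hprod]
  refine integral_congr_ae ?_
  filter_upwards [compl_mem_ae_iff.2 (measure_singleton (0 : ℝ))] with t ht
  have htc : (t : ℂ) ≠ 0 := by exact_mod_cast ht
  have hderiv : ∀ x ∈ uIcc v u, HasDerivAt (fun x : ℝ => cexp (-I * (t * x : ℝ)) * g t / t)
      (-I * (cexp (-I * (t * x : ℝ)) * g t)) x := by
    intro x _
    have h1 : HasDerivAt (fun x : ℝ => -I * ((t * x : ℝ) : ℂ)) (-I * ((t * 1 : ℝ) : ℂ)) x :=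
      (((hasDerivAt_id x).const_mul t).ofReal_comp).const_mul (-I)
    convert! ((h1.cexp).mul_const (g t)).div_const (t : ℂ) using 1
    push_cast
    field_simp
  rw [intervalIntegral.integral_eq_sub_of_hasDerivAt hderiv
    (Continuous.intervalIntegrable (by fun_prop) _ _), sub_div]

theorem gaussN_one_div (σ s : ℝ) :
    ((gaussN (1 / σ) s : ℝ) : ℂ) = cexp (-((σ ^ 2 / 2 : ℝ) : ℂ) * (s : ℂ) ^ 2) := by
  rw [gaussN, ofReal_exp]
  congr 1
  push_cast
  rw [div_pow, one_pow, mul_one_div, div_div_eq_mul_div]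
  ring

theorem integral_exp_mul_gaussN_one_div {σ : ℝ} (hσ : 0 < σ) (ω x : ℝ) :
    ∫ t : ℝ, cexp (-I * (t * x : ℝ)) * ((gaussN (1 / σ) (ω - t) : ℝ) : ℂ) =
      cexp (-I * (ω * x : ℝ)) * ((√(2 * Real.pi) / σ : ℝ) : ℂ) * ((gaussN σ x : ℝ) : ℂ) := by
  have hb : 0 < (((σ ^ 2 / 2 : ℝ) : ℂ)).re := by
    rw [ofReal_re]
    positivity
  rw [← integral_sub_left_eq_self _ volume ω]
  have hpt : ∀ s : ℝ,
      cexp (-I * ((ω - s) * x : ℝ)) * ((gaussN (1 / σ) (ω - (ω - s)) : ℝ) : ℂ) =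
        cexp (-I * (ω * x : ℝ)) *
          (cexp (I * x * s) * cexp (-((σ ^ 2 / 2 : ℝ) : ℂ) * (s : ℂ) ^ 2)) := by
    intro s
    simp only [sub_sub_cancel, gaussN_one_div, ← Complex.exp_add]
    congr 1
    push_cast
    ring
  simp_rw [hpt]
  rw [integral_const_mul, fourierIntegral_gaussian hb, mul_assoc]
  congr 2
  · rw [← ofReal_div, show (1 / 2 : ℂ) = ((1 / 2 : ℝ) : ℂ) by push_cast; rfl,
      ← ofReal_cpow (by positivity), ← Real.sqrt_eq_rpow]
    congr 1
    rw [show Real.pi / (σ ^ 2 / 2) = 2 * Real.pi / σ ^ 2 by field_simp,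
      Real.sqrt_div (by positivity), Real.sqrt_sq hσ.le]
  · rw [gaussN, ofReal_exp]
    congr 1
    push_cast
    ring

theorem setIntegral_lt_abs_sub_div (f : ℝ → ℂ) (ω ε : ℝ) :
    ∫ s in {s : ℝ | ε < |ω - s|}, f s / ((ω : ℂ) - (s : ℂ)) =
      ∫ t in {t : ℝ | ε < |t|}, f (ω - t) / (t : ℂ) := by
  have hm : MeasurableSet {t : ℝ | ε < |t|} := measurableSet_lt measurable_const measurable_norm
  have hm' : MeasurableSet {s : ℝ | ε < |ω - s|} :=
    measurableSet_lt measurable_const (by fun_prop)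
  rw [← integral_indicator hm, ← integral_indicator hm',
    ← integral_sub_left_eq_self ({t : ℝ | ε < |t|}.indicator _) volume ω]
  congr 1
  ext s
  simp [indicator]

/-- The Fourier transform of a Gaussian truncated to `[v,u]` equals
`√(π/2) σ i [(H^u - H^v) N^{1/σ}](ω)`, both principal-value limits existing. -/
theorem doubly_truncated_gaussian_fourier_conjugated_hilbert
    (σ u v ω : ℝ) (hσ : 0 < σ) :
    ∃ Pu Pv : ℂ,
      Filter.Tendsto (fun ε : ℝ =>
          ∫ s in {s : ℝ | ε < |ω - s|},
            Complex.exp (Complex.I * ((s * u : ℝ) : ℂ)) * ((gaussN (1 / σ) s : ℝ) : ℂ) /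
              (((ω : ℝ) : ℂ) - ((s : ℝ) : ℂ)))
        (nhdsWithin (0 : ℝ) (Set.Ioi 0)) (nhds Pu) ∧
      Filter.Tendsto (fun ε : ℝ =>
          ∫ s in {s : ℝ | ε < |ω - s|},
            Complex.exp (Complex.I * ((s * v : ℝ) : ℂ)) * ((gaussN (1 / σ) s : ℝ) : ℂ) /
              (((ω : ℝ) : ℂ) - ((s : ℝ) : ℂ)))
        (nhdsWithin (0 : ℝ) (Set.Ioi 0)) (nhds Pv) ∧
      (∫ x in v..u, Complex.exp (-Complex.I * ((ω * x : ℝ) : ℂ)) * ((gaussN σ x : ℝ) : ℂ)) =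
        ((Real.sqrt (Real.pi / 2) * σ : ℝ) : ℂ) * Complex.I *
          (Complex.exp (-Complex.I * ((ω * u : ℝ) : ℂ)) * ((1 / Real.pi : ℝ) : ℂ) * Pu -
           Complex.exp (-Complex.I * ((ω * v : ℝ) : ℂ)) * ((1 / Real.pi : ℝ) : ℂ) * Pv) := by
  set g : ℝ → ℂ := fun t => ((gaussN (1 / σ) (ω - t) : ℝ) : ℂ) with hg_def
  set H : ℝ → ℝ → ℂ := fun x t => cexp (-I * (t * x : ℝ)) * g t with hH_def
  have hg : Integrable g := by
    have hb : 0 < (((σ ^ 2 / 2 : ℝ) : ℂ)).re := by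
      rw [ofReal_re]
      positivity
    have h := (integrable_cexp_neg_mul_sq hb).comp_sub_left ω
    simpa only [hg_def, gaussN_one_div] using h
  have hgd : Differentiable ℝ g := by
    have h : Differentiable ℝ fun t : ℝ => gaussN (1 / σ) (ω - t) := by
      unfold gaussN
      fun_prop
    exact ofRealCLM.differentiable.comp h
  have hHd (x : ℝ) : Differentiable ℝ (H x) := by
    have h : Differentiable ℝ fun t : ℝ => ((t * x : ℝ) : ℂ) :=
      ofRealCLM.differentiable.comp (g := fun r : ℝ => (r : ℂ)) (f := fun t : ℝ => t * x)
        (by fun_prop)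
    exact ((h.const_mul (-I)).cexp).mul hgd
  have hHi (x : ℝ) : Integrable (H x) := by
    refine hg.mono (hHd x).continuous.aestronglyMeasurable (.of_forall fun t => ?_)
    have : ‖cexp (-I * (t * x : ℝ))‖ = 1 := by
      rw [norm_exp]
      simp
    simp only [hH_def, norm_mul, this, one_mul, le_refl]
  have hlim (x : ℝ) : Tendsto (fun ε : ℝ => ∫ s in {s : ℝ | ε < |ω - s|},
      cexp (I * (s * x : ℝ)) * ((gaussN (1 / σ) s : ℝ) : ℂ) / ((ω : ℂ) - (s : ℂ)))
      (𝓝[>] 0) (𝓝 (cexp (I * (ω * x : ℝ)) * ∫ t, regularizedDiv (H x) t)) := by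
    refine ((tendsto_setIntegral_div_of_differentiableAt_zero (hHd x).continuous (hHi x)
      (hHd x 0)).const_mul _).congr fun ε => ?_
    rw [setIntegral_lt_abs_sub_div
      (fun s : ℝ => cexp (I * (s * x : ℝ)) * ((gaussN (1 / σ) s : ℝ) : ℂ)), ← integral_const_mul]
    congr 1
    ext t
    rw [← mul_div_assoc, ← mul_assoc, ← Complex.exp_add]
    congr 3
    push_cast
    ring
  have hcancel (x : ℝ) (P : ℂ) : cexp (-I * (ω * x : ℝ)) * ((1 / Real.pi : ℝ) : ℂ) *
      (cexp (I * (ω * x : ℝ)) * P) = ((1 / Real.pi : ℝ) : ℂ) * P := by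
    have : cexp (-I * (ω * x : ℝ)) * cexp (I * (ω * x : ℝ)) = 1 := by
      rw [← Complex.exp_add, neg_mul, neg_add_cancel, Complex.exp_zero]
    linear_combination (((1 / Real.pi : ℝ) : ℂ) * P) * this
  refine ⟨_, _, hlim u, hlim v, ?_⟩
  rw [hcancel, hcancel, ← mul_sub, ← integral_sub
    (integrable_regularizedDiv (hHd u).continuous (hHi u) (hHd u 0))
    (integrable_regularizedDiv (hHd v).continuous (hHi v) (hHd v 0))]
  have hdiff : ∀ t, regularizedDiv (H u) t - regularizedDiv (H v) t = (H u t - H v t) / t := by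
    intro t
    have h0 : H u 0 = H v 0 := by simp [hH_def]
    rw [regularizedDiv, regularizedDiv, h0]
    ring
  simp_rw [hdiff]
  rw [integral_exp_sub_exp_mul_div hg u v, intervalIntegral.integral_const_mul]
  simp_rw [hg_def, integral_exp_mul_gaussN_one_div hσ,
    mul_right_comm _ ((√(2 * Real.pi) / σ : ℝ) : ℂ)]
  rw [intervalIntegral.integral_mul_const]
  have hconst : √(Real.pi / 2) * σ * (1 / Real.pi) * (√(2 * Real.pi) / σ) = 1 := by
    have h : √(Real.pi / 2) * √(2 * Real.pi) = Real.pi := by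
      rw [← Real.sqrt_mul (by positivity), show Real.pi / 2 * (2 * Real.pi) = Real.pi ^ 2 by ring,
        Real.sqrt_sq Real.pi_pos.le]
    rw [mul_comm 2 Real.pi] at h ⊢
    field_simp
    exact h
  have hconst' : ((√(Real.pi / 2) * σ : ℝ) : ℂ) * ((1 / Real.pi : ℝ) : ℂ) *
      ((√(2 * Real.pi) / σ : ℝ) : ℂ) = 1 := by
    exact_mod_cast hconst
  generalize (∫ x in v..u, cexp (-I * (ω * x : ℝ)) * ((gaussN σ x : ℝ) : ℂ)) = J
  linear_combination (-J) * hconst' +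
    (J * ((√(Real.pi / 2) * σ : ℝ) : ℂ) * ((1 / Real.pi : ℝ) : ℂ) *
      ((√(2 * Real.pi) / σ : ℝ) : ℂ)) * I_mul_I
end

section
/- Fix σ > 0 and u ∈ ℝ. The function ω ↦ Φ^σ(ω, u) = ∫_{−∞}^{u} exp(−iωx) N^σ(x) dx is differentiable on ℝ and satisfies the linear ordinary differential equation d/dω Φ^σ(ω, u) + σ² ω Φ^σ(ω, u) = i σ² exp(−i u ω) N^σ(u) for every ω ∈ ℝ. -/
open MeasureTheory Complex

/-- The truncated-Gaussian Fourier integral `Φ^σ(ω,u) = ∫_{-∞}^u exp(-iωx) N^σ(x) dx`. -/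
noncomputable def Phi (σ ω u : ℝ) : ℂ :=
  ∫ x in Set.Iic u, Complex.exp (-Complex.I * ((ω * x : ℝ) : ℂ)) * ((gaussN σ x : ℝ) : ℂ)

theorem gaussN_pos (β x : ℝ) : 0 < gaussN β x :=
  Real.exp_pos _

theorem continuous_gaussN (β : ℝ) : Continuous (gaussN β) := by
  unfold gaussN
  fun_prop

theorem tendsto_gaussN_atBot {β : ℝ} (hβ : 0 < β) :
    Filter.Tendsto (gaussN β) Filter.atBot (nhds 0) := by
  have h := tendsto_rpow_abs_mul_exp_neg_mul_sq_cocompact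
    (a := 1 / (2 * β ^ 2)) (by positivity) 0
  simp only [Real.rpow_zero, one_mul, ← gaussN_eq_exp_neg_mul_sq] at h
  exact h.mono_left atBot_le_cocompact

theorem hasDerivAt_gaussN (β x : ℝ) : HasDerivAt (gaussN β) (-x / β ^ 2 * gaussN β x) x := by
  have h := (((hasDerivAt_pow 2 x).neg).div_const (2 * β ^ 2)).exp
  refine h.congr_deriv ?_
  simp only [gaussN, Pi.neg_apply]
  push_cast
  field_simp

theorem norm_exp_neg_I_mul_ofReal (t : ℝ) : ‖Complex.exp (-Complex.I * (t : ℂ))‖ = 1 := by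
  have h := Complex.norm_exp_ofReal_mul_I (-t)
  rwa [show ((-t : ℝ) : ℂ) * I = -I * (t : ℂ) by push_cast; ring] at h

/-- The integrand of `Phi`. -/
noncomputable def gaussFourier (σ ω x : ℝ) : ℂ :=
  Complex.exp (-Complex.I * ((ω * x : ℝ) : ℂ)) * ((gaussN σ x : ℝ) : ℂ)

theorem continuous_gaussFourier (σ ω : ℝ) : Continuous (gaussFourier σ ω) := by
  have := continuous_gaussN σ
  unfold gaussFourier
  fun_prop

theorem norm_gaussFourier (σ ω x : ℝ) : ‖gaussFourier σ ω x‖ = gaussN σ x := by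
  rw [gaussFourier, norm_mul, norm_exp_neg_I_mul_ofReal, one_mul, norm_real,
    Real.norm_of_nonneg (gaussN_pos σ x).le]

theorem integrable_gaussFourier {σ : ℝ} (hσ : 0 < σ) (ω : ℝ) : Integrable (gaussFourier σ ω) :=
  (integrable_gaussN hσ).mono' (continuous_gaussFourier σ ω).aestronglyMeasurable
    (.of_forall fun x => (norm_gaussFourier σ ω x).le)

theorem tendsto_gaussFourier_atBot {σ : ℝ} (hσ : 0 < σ) (ω : ℝ) :
    Filter.Tendsto (gaussFourier σ ω) Filter.atBot (nhds 0) := by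
  rw [tendsto_zero_iff_norm_tendsto_zero]
  simpa only [norm_gaussFourier] using tendsto_gaussN_atBot hσ

theorem hasDerivAt_gaussFourier_frequency (σ ω x : ℝ) :
    HasDerivAt (fun ω' => gaussFourier σ ω' x) (-I * x * gaussFourier σ ω x) ω := by
  have h : HasDerivAt (fun ω' : ℝ => -I * ((ω' * x : ℝ) : ℂ)) (-I * x) ω := by
    simpa using (((hasDerivAt_id ω).mul_const x).ofReal_comp).const_mul (-I)
  refine (h.cexp.mul_const ((gaussN σ x : ℝ) : ℂ)).congr_deriv ?_
  rw [gaussFourier]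
  ring

theorem hasDerivAt_gaussFourier (σ ω x : ℝ) :
    HasDerivAt (gaussFourier σ ω) ((-I * ω - x / σ ^ 2) * gaussFourier σ ω x) x := by
  have h : HasDerivAt (fun x' : ℝ => -I * ((ω * x' : ℝ) : ℂ)) (-I * ω) x := by
    simpa using (((hasDerivAt_id x).const_mul ω).ofReal_comp).const_mul (-I)
  refine (h.cexp.mul (hasDerivAt_gaussN σ x).ofReal_comp).congr_deriv ?_
  rw [gaussFourier]
  push_cast
  ring

theorem hasDerivAt_Phi_integral {σ : ℝ} (hσ : 0 < σ) (u ω : ℝ) :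
    IntegrableOn (fun x : ℝ => -I * x * gaussFourier σ ω x) (Set.Iic u) ∧
      HasDerivAt (fun ω' => Phi σ ω' u)
        (∫ x in Set.Iic u, -I * (x : ℂ) * gaussFourier σ ω x) ω := by
  refine hasDerivAt_integral_of_dominated_loc_of_deriv_le
    (F := gaussFourier σ) (F' := fun ω' x => -I * x * gaussFourier σ ω' x)
    (bound := fun x => ‖x * gaussN σ x‖) Filter.univ_mem
    (.of_forall fun ω' => (continuous_gaussFourier σ ω').aestronglyMeasurable)
    (integrable_gaussFourier hσ ω).integrableOn ?_ ?_
    (integrable_mul_gaussN hσ).norm.integrableOn ?_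
  · have := continuous_gaussFourier σ ω
    exact Continuous.aestronglyMeasurable (by fun_prop)
  · refine .of_forall fun x ω' _ => le_of_eq ?_
    simp [norm_gaussFourier, abs_of_pos (gaussN_pos σ x)]
  · exact .of_forall fun x ω' _ => hasDerivAt_gaussFourier_frequency σ ω' x

theorem integral_Iic_neg_I_mul_gaussFourier {σ : ℝ} (hσ : 0 < σ) (u ω : ℝ) :
    ∫ x in Set.Iic u, -I * (x : ℂ) * gaussFourier σ ω x =
      I * σ ^ 2 * gaussFourier σ ω u - σ ^ 2 * ω * Phi σ ω u := by
  have hσ' : (σ : ℂ) ≠ 0 := mod_cast hσ.ne'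
  have hint := (integrable_gaussFourier hσ ω).integrableOn (s := Set.Iic u)
  have hderiv (x : ℝ) : HasDerivAt (fun x => I * σ ^ 2 * gaussFourier σ ω x)
      (-I * x * gaussFourier σ ω x + σ ^ 2 * ω * gaussFourier σ ω x) x := by
    refine ((hasDerivAt_gaussFourier σ ω x).const_mul (I * (σ : ℂ) ^ 2)).congr_deriv ?_
    field_simp
    linear_combination -(σ : ℂ) ^ 2 * ω * gaussFourier σ ω x * I_sq
  have h := integral_Iic_of_hasDerivAt_of_tendsto' (a := u) (fun x _ => hderiv x)
    ((hasDerivAt_Phi_integral hσ u ω).1.add (hint.const_mul _))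
    ((tendsto_gaussFourier_atBot hσ ω).const_mul _)
  rw [integral_add (hasDerivAt_Phi_integral hσ u ω).1 (hint.const_mul _),
    integral_const_mul, mul_zero, sub_zero] at h
  exact eq_sub_of_add_eq h

/-- `ω ↦ Φ^σ(ω,u)` is differentiable and satisfies the linear ODE
`d/dω Φ^σ(ω,u) + σ²ω Φ^σ(ω,u) = iσ² exp(-iuω) N^σ(u)`. -/
theorem truncated_gaussian_fourier_ode (σ u : ℝ) (hσ : 0 < σ) :
    ∀ ω : ℝ, HasDerivAt (fun ω' : ℝ => Phi σ ω' u)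
      (Complex.I * ((σ ^ 2 : ℝ) : ℂ) * Complex.exp (-Complex.I * ((u * ω : ℝ) : ℂ)) *
          ((gaussN σ u : ℝ) : ℂ) -
        ((σ ^ 2 * ω : ℝ) : ℂ) * Phi σ ω u) ω := by
  intro ω
  refine (hasDerivAt_Phi_integral hσ u ω).2.congr_deriv ?_
  rw [integral_Iic_neg_I_mul_gaussFourier hσ, gaussFourier, mul_comm ω u]
  push_cast
  ring
end

section
/- Let β > 0 and u ∈ ℝ, and define the conjugated Hilbert transform H^u f(ω) = exp(−iωu) · (1/π) · p.v. ∫_{ℝ} exp(isu) f(s)/(ω − s) ds. Then: (i) for every ω ∈ ℝ the principal-value limit defining g(ω) = H^u N^β(ω) exists; (ii) for every ω ∈ ℝ the principal-value limit defining H^u g(ω) exists; and (iii) H^u( H^u N^β )(ω) = −N^β(ω) for all ω ∈ ℝ. -/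
open MeasureTheory Complex

open Set Filter Topology

/-- The sine integral `x ↦ ∫₀ˣ sin t / t dt`. -/
noncomputable def sineIntegral (x : ℝ) : ℝ := ∫ t in (0 : ℝ)..x, Real.sinc t

lemma hasDerivAt_sineIntegral (x : ℝ) : HasDerivAt sineIntegral (Real.sinc x) x :=
  intervalIntegral.integral_hasDerivAt_right
    (Real.continuous_sinc.intervalIntegrable _ _)
    (Real.stronglyMeasurable_sinc.stronglyMeasurableAtFilter)
    Real.continuous_sinc.continuousAt

lemma continuous_sineIntegral : Continuous sineIntegral :=
  continuous_iff_continuousAt.2 fun x => (hasDerivAt_sineIntegral x).continuousAt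

lemma sineIntegral_zero : sineIntegral 0 = 0 := by simp [sineIntegral]

lemma sineIntegral_neg (x : ℝ) : sineIntegral (-x) = -sineIntegral x := by
  have h := intervalIntegral.integral_comp_neg (a := 0) (b := x) (fun t => Real.sinc t)
  simp only [Real.sinc_neg, neg_zero] at h
  rw [sineIntegral, sineIntegral, h, intervalIntegral.integral_symm]

/-- The integrand of the auxiliary function `sineIntegralTail`. -/
noncomputable def sineIntegralKernel (R y : ℝ) : ℝ :=
  Real.exp (-R * y) * (Real.cos R + y * Real.sin R) * (1 + y ^ 2)⁻¹

/-- The difference `π / 2 - sineIntegral R` for `R > 0`, as a Laplace transform. -/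
noncomputable def sineIntegralTail (R : ℝ) : ℝ := ∫ y in Ioi (0 : ℝ), sineIntegralKernel R y

lemma continuous_sineIntegralKernel (R : ℝ) : Continuous (sineIntegralKernel R) := by
  unfold sineIntegralKernel
  have : ∀ y : ℝ, 1 + y ^ 2 ≠ 0 := fun y => by positivity
  fun_prop (disch := assumption)

lemma abs_sineIntegralKernel_le_exp (R : ℝ) {y : ℝ} (hy : 0 < y) :
    |sineIntegralKernel R y| ≤ 2 * Real.exp (-R * y) := by
  have h1 : |Real.cos R + y * Real.sin R| ≤ 1 + y := by
    refine (abs_add_le _ _).trans (add_le_add (Real.abs_cos_le_one R) ?_)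
    rw [abs_mul, abs_of_pos hy]
    exact mul_le_of_le_one_right hy.le (Real.abs_sin_le_one R)
  have h2 : (1 + y) * (1 + y ^ 2)⁻¹ ≤ 2 := by
    rw [← div_eq_mul_inv, div_le_iff₀ (by positivity)]
    nlinarith [sq_nonneg (y - 1)]
  rw [sineIntegralKernel, abs_mul, abs_mul, abs_of_pos (Real.exp_pos _),
    abs_of_pos (by positivity : (0 : ℝ) < (1 + y ^ 2)⁻¹), mul_assoc, mul_comm (2 : ℝ)]
  gcongr
  exact (mul_le_mul_of_nonneg_right h1 (by positivity)).trans h2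

lemma abs_sineIntegralKernel_le_inv {R y : ℝ} (hR : 0 < R) (hy : 0 < y) :
    |sineIntegralKernel R y| ≤ (1 + y ^ 2)⁻¹ := by
  have h1 : |Real.cos R + y * Real.sin R| ≤ R * y + 1 := by
    refine (abs_add_le _ _).trans ?_
    rw [abs_mul, abs_of_pos hy, add_comm, mul_comm R]
    have := Real.abs_sin_le_abs (x := R)
    rw [abs_of_pos hR] at this
    gcongr
    exact Real.abs_cos_le_one R
  have h2 : Real.exp (-R * y) * (R * y + 1) ≤ 1 := by
    calc Real.exp (-R * y) * (R * y + 1) ≤ Real.exp (-R * y) * Real.exp (R * y) := by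
          gcongr
          exact Real.add_one_le_exp _
      _ = 1 := by rw [← Real.exp_add]; simp
  rw [sineIntegralKernel, abs_mul, abs_mul, abs_of_pos (Real.exp_pos _),
    abs_of_pos (by positivity : (0 : ℝ) < (1 + y ^ 2)⁻¹)]
  refine mul_le_of_le_one_left (by positivity) (le_trans ?_ h2)
  gcongr

lemma integrableOn_exp_neg_mul {R : ℝ} (hR : 0 < R) :
    IntegrableOn (fun y : ℝ => Real.exp (-R * y)) (Ioi 0) :=
  integrableOn_exp_mul_Ioi (neg_lt_zero.2 hR) 0

lemma hasDerivAt_sineIntegralTail {R : ℝ} (hR : 0 < R) :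
    HasDerivAt sineIntegralTail (-Real.sinc R) R := by
  have key := hasDerivAt_integral_of_dominated_loc_of_deriv_le
    (μ := volume.restrict (Ioi (0 : ℝ))) (F := sineIntegralKernel)
    (F' := fun R y => -(Real.exp (-R * y) * Real.sin R))
    (bound := fun y => Real.exp (-(R / 2) * y)) (s := Ioi (R / 2)) (x₀ := R)
    (Ioi_mem_nhds (by linarith))
    (Eventually.of_forall fun R => (continuous_sineIntegralKernel R).aestronglyMeasurable)
    (((integrableOn_exp_neg_mul hR).const_mul 2).mono'
      (continuous_sineIntegralKernel R).aestronglyMeasurable ?_)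
    (by fun_prop) ?_ (integrableOn_exp_neg_mul (half_pos hR)) ?_
  · have h := key.2
    have hval : ∫ y in Ioi (0 : ℝ), -(Real.exp (-R * y) * Real.sin R) = -Real.sinc R := by
      rw [integral_neg, integral_mul_const, integral_exp_mul_Ioi (neg_lt_zero.2 hR),
        Real.sinc_of_ne_zero hR.ne']
      simp
      field_simp
    rwa [hval] at h
  · exact (ae_restrict_iff' measurableSet_Ioi).2 <| Eventually.of_forall fun y hy =>
      abs_sineIntegralKernel_le_exp R hy
  · refine (ae_restrict_iff' measurableSet_Ioi).2 <| Eventually.of_forall fun y hy x hx => ?_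
    rw [norm_neg, norm_mul, Real.norm_of_nonneg (Real.exp_pos _).le]
    refine (mul_le_of_le_one_right (Real.exp_pos _).le (Real.abs_sin_le_one x)).trans ?_
    have hx' : R / 2 < x := hx
    have hy' : 0 < y := hy
    gcongr
  · refine Eventually.of_forall fun y x _ => ?_
    have h1 : HasDerivAt (fun R : ℝ => Real.exp (-R * y)) (Real.exp (-x * y) * (-1 * y)) x :=
      (((hasDerivAt_id x).neg).mul_const y).exp
    have h2 : HasDerivAt (fun R : ℝ => Real.cos R + y * Real.sin R)
        (-Real.sin x + y * Real.cos x) x :=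
      (Real.hasDerivAt_cos x).add ((Real.hasDerivAt_sin x).const_mul y)
    have h3 := (h1.mul h2).mul_const ((1 + y ^ 2)⁻¹)
    have hy : 1 + y ^ 2 ≠ 0 := by positivity
    refine h3.congr_deriv ?_
    field_simp
    ring

lemma sineIntegralTail_tendsto_zero : Tendsto sineIntegralTail (𝓝[>] 0) (𝓝 (Real.pi / 2)) := by
  have hval : ∫ y in Ioi (0 : ℝ), (1 + y ^ 2)⁻¹ = Real.pi / 2 := by simp
  rw [← hval]
  refine tendsto_integral_filter_of_dominated_convergence (fun y : ℝ => (1 + y ^ 2)⁻¹)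
    (Eventually.of_forall fun R => (continuous_sineIntegralKernel R).aestronglyMeasurable) ?_
    integrable_inv_one_add_sq.integrableOn ?_
  · filter_upwards [self_mem_nhdsWithin] with R hR
    exact (ae_restrict_iff' measurableSet_Ioi).2 <| Eventually.of_forall fun y hy =>
      abs_sineIntegralKernel_le_inv hR hy
  · refine Eventually.of_forall fun y => ?_
    have hc : Continuous fun R => sineIntegralKernel R y := by
      unfold sineIntegralKernel
      fun_prop
    have := hc.tendsto 0
    simp only [sineIntegralKernel, neg_zero, zero_mul, Real.exp_zero, Real.cos_zero,
      Real.sin_zero, mul_zero, add_zero, one_mul] at this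
    exact this.mono_left nhdsWithin_le_nhds

lemma sineIntegralTail_tendsto_atTop : Tendsto sineIntegralTail atTop (𝓝 0) := by
  refine squeeze_zero_norm' (a := fun R : ℝ => 2 / R) ?_ (tendsto_const_nhds.div_atTop tendsto_id)
  filter_upwards [eventually_gt_atTop 0] with R hR
  refine (norm_integral_le_of_norm_le ((integrableOn_exp_neg_mul hR).const_mul 2)
    ((ae_restrict_iff' measurableSet_Ioi).2 <| Eventually.of_forall fun y hy =>
      abs_sineIntegralKernel_le_exp R hy)).trans (le_of_eq ?_)
  rw [integral_const_mul, integral_exp_mul_Ioi (neg_lt_zero.2 hR)]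
  simp
  field_simp

lemma sineIntegral_add_tail {R : ℝ} (hR : 0 < R) :
    sineIntegral R + sineIntegralTail R = Real.pi / 2 := by
  have hd : ∀ x ∈ Ioi (0 : ℝ), HasDerivAt (fun x => sineIntegral x + sineIntegralTail x) 0 x :=
    fun x hx => by
      exact ((hasDerivAt_sineIntegral x).add (hasDerivAt_sineIntegralTail hx)).congr_deriv
        (add_neg_cancel _)
  have hconst : ∀ x ∈ Ioi (0 : ℝ),
      sineIntegral x + sineIntegralTail x = sineIntegral R + sineIntegralTail R := fun x hx =>
    isOpen_Ioi.is_const_of_deriv_eq_zero isPreconnected_Ioi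
      (fun y hy => (hd y hy).differentiableAt.differentiableWithinAt)
      (fun y hy => (hd y hy).deriv) hx hR
  have h0 : Tendsto (fun x => sineIntegral x + sineIntegralTail x) (𝓝[>] 0)
      (𝓝 (0 + Real.pi / 2)) := by
    refine Tendsto.add ?_ sineIntegralTail_tendsto_zero
    have := continuous_sineIntegral.tendsto 0
    rw [sineIntegral_zero] at this
    exact this.mono_left nhdsWithin_le_nhds
  rw [zero_add] at h0
  refine tendsto_nhds_unique ?_ h0
  refine tendsto_const_nhds.congr' ?_
  filter_upwards [self_mem_nhdsWithin] with x hx using (hconst x hx).symm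

/-- The Dirichlet integral. -/
lemma tendsto_sineIntegral_atTop : Tendsto sineIntegral atTop (𝓝 (Real.pi / 2)) := by
  have h := (tendsto_const_nhds (x := Real.pi / 2)).sub sineIntegralTail_tendsto_atTop
  rw [sub_zero] at h
  refine h.congr' ?_
  filter_upwards [eventually_gt_atTop 0] with R hR
  linarith [sineIntegral_add_tail hR]

lemma tendsto_sineIntegral_mul_atTop (ξ : ℝ) :
    Tendsto (fun R => sineIntegral (ξ * R)) atTop (𝓝 (Real.pi / 2 * Real.sign ξ)) := by
  rcases lt_trichotomy ξ 0 with h | h | h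
  · have h1 := (tendsto_sineIntegral_atTop.comp
      (tendsto_id.const_mul_atTop (neg_pos.2 h))).neg
    rw [Real.sign_of_neg h, mul_neg, mul_one]
    refine h1.congr fun R => ?_
    simp [sineIntegral_neg]
  · simp [h, sineIntegral_zero]
  · rw [Real.sign_of_pos h, mul_one]
    exact tendsto_sineIntegral_atTop.comp (tendsto_id.const_mul_atTop h)

lemma exists_abs_sineIntegral_le : ∃ C, ∀ x, |sineIntegral x| ≤ C := by
  obtain ⟨M, hM⟩ := eventually_atTop.1
    (tendsto_sineIntegral_atTop.abs.eventually_le_const (lt_add_one _))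
  obtain ⟨K, hK⟩ := (isCompact_Icc (a := (0 : ℝ)) (b := M)).exists_bound_of_continuousOn
    continuous_sineIntegral.continuousOn
  have hpos : ∀ x, 0 ≤ x → |sineIntegral x| ≤ max (|Real.pi / 2| + 1) K := fun x hx => by
    rcases le_total M x with h | h
    · exact (hM x h).trans (le_max_left _ _)
    · exact (hK x ⟨hx, h⟩).trans (le_max_right _ _)
  refine ⟨max (|Real.pi / 2| + 1) K, fun x => ?_⟩
  rcases le_total 0 x with h | h
  · exact hpos x h
  · simpa [sineIntegral_neg] using hpos (-x) (neg_nonneg.2 h)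

lemma integral_sin_mul_div {ε R : ℝ} (hε : 0 < ε) (hR : ε ≤ R) (ξ : ℝ) :
    ∫ t in ε..R, Real.sin (ξ * t) / t = sineIntegral (ξ * R) - sineIntegral (ξ * ε) := by
  have hd : ∀ t ∈ uIcc ε R,
      HasDerivAt (fun t => sineIntegral (ξ * t)) (Real.sin (ξ * t) / t) t := fun t ht => by
    rw [uIcc_of_le hR] at ht
    have ht0 : t ≠ 0 := (hε.trans_le ht.1).ne'
    have h := (hasDerivAt_sineIntegral (ξ * t)).comp t ((hasDerivAt_id t).const_mul ξ)
    refine h.congr_deriv ?_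
    rcases eq_or_ne ξ 0 with rfl | hξ
    · simp
    · rw [Real.sinc_of_ne_zero (mul_ne_zero hξ ht0)]
      field_simp
  rw [intervalIntegral.integral_eq_sub_of_hasDerivAt hd]
  refine ContinuousOn.intervalIntegrable ?_
  rw [uIcc_of_le hR]
  exact ContinuousOn.div (by fun_prop) continuousOn_id fun t ht => (hε.trans_le ht.1).ne'

/-- The inverse Fourier transform `s ↦ ∫ m(ξ) exp(isξ) dξ` (without normalization). -/
noncomputable def expTransform (m : ℝ → ℂ) (s : ℝ) : ℂ :=
  ∫ ξ : ℝ, m ξ * Complex.exp (Complex.I * ((s * ξ : ℝ) : ℂ))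

lemma norm_exp_I_mul (x : ℝ) : ‖Complex.exp (Complex.I * (x : ℂ))‖ = 1 := by
  rw [mul_comm, Complex.norm_exp_ofReal_mul_I]

lemma MeasureTheory.Integrable.mul_exp_I {μ : Measure ℝ} {m : ℝ → ℂ} (hm : Integrable m μ)
    (s : ℝ) : Integrable (fun ξ : ℝ => m ξ * Complex.exp (Complex.I * ((s * ξ : ℝ) : ℂ))) μ :=
  hm.mul_bdd (c := 1) (by fun_prop) (Eventually.of_forall fun ξ => (norm_exp_I_mul _).le)

lemma norm_expTransform_le (m : ℝ → ℂ) (s : ℝ) : ‖expTransform m s‖ ≤ ∫ ξ, ‖m ξ‖ := by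
  refine (norm_integral_le_integral_norm _).trans (le_of_eq ?_)
  simp_rw [norm_mul, norm_exp_I_mul, mul_one]

lemma continuous_expTransform {m : ℝ → ℂ} (hm : Integrable m) : Continuous (expTransform m) := by
  refine continuous_of_dominated (bound := fun ξ => ‖m ξ‖)
    (fun s => (hm.mul_exp_I s).aestronglyMeasurable) (fun s => ?_) hm.norm ?_
  · exact Eventually.of_forall fun ξ => by rw [norm_mul, norm_exp_I_mul, mul_one]
  · exact Eventually.of_forall fun ξ => by fun_prop

lemma setIntegral_div_sub_eq {G : ℝ → ℂ} {ω ε : ℝ} (hε : 0 < ε)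
    (hG : IntegrableOn (fun s : ℝ => G s / ((ω : ℂ) - (s : ℂ))) {s : ℝ | ε < |ω - s|}) :
    IntegrableOn (fun t : ℝ => (G (ω - t) - G (ω + t)) / (t : ℂ)) (Ioi ε) ∧
      ∫ s in {s : ℝ | ε < |ω - s|}, G s / ((ω : ℂ) - (s : ℂ)) =
        ∫ t in Ioi ε, (G (ω - t) - G (ω + t)) / (t : ℂ) := by
  have hset : {s : ℝ | ε < |ω - s|} = Iio (ω - ε) ∪ Ioi (ω + ε) := by
    ext s
    simp only [mem_ofPred_eq, lt_abs, mem_union, mem_Iio, mem_Ioi]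
    constructor <;> rintro (h | h)
    · left; linarith
    · right; linarith
    · left; linarith
    · right; linarith
  rw [hset] at hG ⊢
  have hl := hG.mono_set subset_union_left
  have hr := hG.mono_set subset_union_right
  have hsub : (fun t => ω - t) ⁻¹' Iio (ω - ε) = Ioi ε := by ext; simp
  have hadd : (fun t => ω + t) ⁻¹' Ioi (ω + ε) = Ioi ε := by ext; simp
  have mpsub := Measure.measurePreserving_sub_left (volume : Measure ℝ) ω
  have mpadd := measurePreserving_add_left (volume : Measure ℝ) ω
  have esub : MeasurableEmbedding fun t : ℝ => ω - t := measurableEmbedding_subLeft ω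
  have eadd : MeasurableEmbedding fun t : ℝ => ω + t := measurableEmbedding_addLeft ω
  have hl' := (mpsub.integrableOn_comp_preimage esub).2 hl
  have hr' := (mpadd.integrableOn_comp_preimage eadd).2 hr
  have il := mpsub.setIntegral_preimage_emb esub
    (fun s : ℝ => G s / ((ω : ℂ) - (s : ℂ))) (Iio (ω - ε))
  have ir := mpadd.setIntegral_preimage_emb eadd
    (fun s : ℝ => G s / ((ω : ℂ) - (s : ℂ))) (Ioi (ω + ε))
  rw [hsub] at hl' il
  rw [hadd] at hr' ir
  have hfun : (fun t : ℝ => (G (ω - t) - G (ω + t)) / (t : ℂ)) = fun t : ℝ =>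
      G (ω - t) / ((ω : ℂ) - ((ω - t : ℝ) : ℂ)) + G (ω + t) / ((ω : ℂ) - ((ω + t : ℝ) : ℂ)) := by
    funext t
    push_cast
    rw [sub_sub_cancel, sub_add_cancel_left, div_neg, sub_div, sub_eq_add_neg]
  rw [hfun]
  refine ⟨hl'.add hr', ?_⟩
  have hdisj : Disjoint (Iio (ω - ε)) (Ioi (ω + ε)) :=
    Set.disjoint_left.2 fun x hx hx' => by
      rw [mem_Iio] at hx
      rw [mem_Ioi] at hx'
      linarith
  rw [setIntegral_union hdisj measurableSet_Ioi hl hr, ← il, ← ir]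
  exact (integral_add hl' hr').symm

lemma expTransform_sub_div {m : ℝ → ℂ} (hm : Integrable m) (ω t : ℝ) :
    (expTransform m (ω - t) - expTransform m (ω + t)) / (t : ℂ) =
      ∫ ξ : ℝ, m ξ * Complex.exp (Complex.I * ((ω * ξ : ℝ) : ℂ)) *
        (-2 * Complex.I * ((Real.sin (ξ * t) / t : ℝ) : ℂ)) := by
  rw [expTransform, expTransform, ← integral_sub (hm.mul_exp_I _) (hm.mul_exp_I _),
    ← integral_div]
  congr 1
  funext ξ
  have h1 : Complex.exp (Complex.I * (((ω - t) * ξ : ℝ) : ℂ)) =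
      Complex.exp (Complex.I * ((ω * ξ : ℝ) : ℂ)) * Complex.exp (-((ξ * t : ℝ) : ℂ) * Complex.I) := by
    rw [← Complex.exp_add]
    congr 1
    push_cast
    ring
  have h2 : Complex.exp (Complex.I * (((ω + t) * ξ : ℝ) : ℂ)) =
      Complex.exp (Complex.I * ((ω * ξ : ℝ) : ℂ)) * Complex.exp (((ξ * t : ℝ) : ℂ) * Complex.I) := by
    rw [← Complex.exp_add]
    congr 1
    push_cast
    ring
  rw [h1, h2, Complex.exp_mul_I, Complex.exp_mul_I, Complex.cos_neg, Complex.sin_neg,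
    Complex.ofReal_div, Complex.ofReal_sin]
  ring

lemma integral_expTransform_sub_div {m : ℝ → ℂ} (hm : Integrable m) (ω : ℝ) {ε R : ℝ}
    (hε : 0 < ε) (hR : ε ≤ R) :
    ∫ t in ε..R, (expTransform m (ω - t) - expTransform m (ω + t)) / (t : ℂ) =
      ∫ ξ : ℝ, m ξ * Complex.exp (Complex.I * ((ω * ξ : ℝ) : ℂ)) *
        (-2 * Complex.I * ((sineIntegral (ξ * R) - sineIntegral (ξ * ε) : ℝ) : ℂ)) := by
  simp_rw [expTransform_sub_div hm]
  rw [intervalIntegral.integral_of_le hR, integral_integral_swap]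
  · congr 1
    funext ξ
    rw [integral_const_mul, integral_const_mul, integral_complex_ofReal,
      ← intervalIntegral.integral_of_le hR, integral_sin_mul_div hε hR]
  · refine (((hm.mul_exp_I ω).comp_snd (volume.restrict (Ioc ε R))).mul_bdd
      (c := 2 * ε⁻¹) ?_ ?_)
    · refine Measurable.aestronglyMeasurable ?_
      fun_prop
    · have hmem : ∀ᵐ p : ℝ × ℝ ∂((volume.restrict (Ioc ε R)).prod volume), p.1 ∈ Ioc ε R :=
        Measure.quasiMeasurePreserving_fst.ae (ae_restrict_mem measurableSet_Ioc)
      filter_upwards [hmem] with p hp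
      have hp0 : 0 < p.1 := hε.trans hp.1
      rw [norm_mul, Complex.norm_real, norm_div, Real.norm_of_nonneg hp0.le]
      have : ‖-2 * Complex.I‖ = 2 := by simp
      rw [this, ← one_div]
      gcongr
      · exact Real.abs_sin_le_one _
      · exact hp.1.le

lemma integral_Ioi_expTransform_sub_div {m : ℝ → ℂ} (hm : Integrable m) (ω : ℝ) {ε : ℝ}
    (hε : 0 < ε)
    (hint : IntegrableOn (fun t : ℝ =>
      (expTransform m (ω - t) - expTransform m (ω + t)) / (t : ℂ)) (Ioi ε)) :
    ∫ t in Ioi ε, (expTransform m (ω - t) - expTransform m (ω + t)) / (t : ℂ) =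
      ∫ ξ : ℝ, m ξ * Complex.exp (Complex.I * ((ω * ξ : ℝ) : ℂ)) *
        (-2 * Complex.I * ((Real.pi / 2 * Real.sign ξ - sineIntegral (ξ * ε) : ℝ) : ℂ)) := by
  obtain ⟨C, hC⟩ := exists_abs_sineIntegral_le
  refine tendsto_nhds_unique (intervalIntegral_tendsto_integral_Ioi ε hint tendsto_id) ?_
  refine Tendsto.congr' (f₁ := fun R : ℝ =>
    ∫ ξ : ℝ, m ξ * Complex.exp (Complex.I * ((ω * ξ : ℝ) : ℂ)) *
        (-2 * Complex.I * ((sineIntegral (ξ * R) - sineIntegral (ξ * ε) : ℝ) : ℂ))) ?_ ?_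
  · filter_upwards [eventually_ge_atTop ε] with R hR
    exact (integral_expTransform_sub_div hm ω hε hR).symm
  · have := continuous_sineIntegral
    refine tendsto_integral_filter_of_dominated_convergence (fun ξ => ‖m ξ‖ * (2 * (C + C)))
      (Eventually.of_forall fun R => (hm.mul_exp_I ω).aestronglyMeasurable.mul (by fun_prop))
      (Eventually.of_forall fun R => Eventually.of_forall fun ξ => ?_)
      (hm.norm.mul_const _) (Eventually.of_forall fun ξ => ?_)
    · rw [norm_mul, norm_mul, norm_exp_I_mul, mul_one, norm_mul, Complex.norm_real]
      have : ‖-2 * Complex.I‖ = 2 := by simp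
      rw [this]
      gcongr
      exact (norm_sub_le _ _).trans (add_le_add (hC _) (hC _))
    · refine Tendsto.const_mul _ (Tendsto.const_mul _ ?_)
      exact (Complex.continuous_ofReal.tendsto _).comp
        ((tendsto_sineIntegral_mul_atTop ξ).sub_const _)

lemma measurable_sign : Measurable Real.sign :=
  Measurable.ite measurableSet_Iio measurable_const
    (Measurable.ite measurableSet_Ioi measurable_const measurable_const)

lemma abs_sign_le_one (x : ℝ) : |Real.sign x| ≤ 1 := by
  rcases Real.sign_apply_eq x with h | h | h <;> simp [h]

/-- The principal value of `∫ G(s) / (ω - s) ds` for `G = expTransform m` is obtained by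
multiplying `m` by `-iπ sign`. -/
lemma tendsto_principalValue_expTransform {m : ℝ → ℂ} (hm : Integrable m) (ω : ℝ)
    (hint : ∀ ε : ℝ, 0 < ε → IntegrableOn
      (fun s : ℝ => expTransform m s / ((ω : ℂ) - (s : ℂ))) {s : ℝ | ε < |ω - s|}) :
    Tendsto (fun ε : ℝ => ∫ s in {s : ℝ | ε < |ω - s|},
        expTransform m s / ((ω : ℂ) - (s : ℂ))) (𝓝[>] 0)
      (𝓝 (-(Complex.I * Real.pi) * expTransform (fun ξ => (Real.sign ξ : ℂ) * m ξ) ω)) := by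
  obtain ⟨C, hC⟩ := exists_abs_sineIntegral_le
  have hval : -(Complex.I * Real.pi) * expTransform (fun ξ => (Real.sign ξ : ℂ) * m ξ) ω =
      ∫ ξ : ℝ, m ξ * Complex.exp (Complex.I * ((ω * ξ : ℝ) : ℂ)) *
        (-2 * Complex.I * ((Real.pi / 2 * Real.sign ξ - 0 : ℝ) : ℂ)) := by
    rw [expTransform, ← integral_const_mul]
    congr 1
    funext ξ
    push_cast
    ring
  rw [hval]
  refine Tendsto.congr' (f₁ := fun ε : ℝ =>
    ∫ ξ : ℝ, m ξ * Complex.exp (Complex.I * ((ω * ξ : ℝ) : ℂ)) *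
        (-2 * Complex.I *
          ((Real.pi / 2 * Real.sign ξ - sineIntegral (ξ * ε) : ℝ) : ℂ))) ?_ ?_
  · filter_upwards [self_mem_nhdsWithin] with ε hε
    obtain ⟨h1, h2⟩ := setIntegral_div_sub_eq hε (hint ε hε)
    rw [h2, integral_Ioi_expTransform_sub_div hm ω hε h1]
  · have hcont := continuous_sineIntegral
    refine tendsto_integral_filter_of_dominated_convergence
      (fun ξ => ‖m ξ‖ * (2 * (Real.pi / 2 + C)))
      (Eventually.of_forall fun R => (hm.mul_exp_I ω).aestronglyMeasurable.mul
        (Measurable.aestronglyMeasurable (by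
          have := hcont.measurable
          have := measurable_sign
          fun_prop)))
      (Eventually.of_forall fun R => Eventually.of_forall fun ξ => ?_)
      (hm.norm.mul_const _) (Eventually.of_forall fun ξ => ?_)
    · rw [norm_mul, norm_mul, norm_exp_I_mul, mul_one, norm_mul, Complex.norm_real]
      have : ‖-2 * Complex.I‖ = 2 := by simp
      rw [this]
      gcongr
      refine (norm_sub_le _ _).trans (add_le_add ?_ (hC _))
      rw [norm_mul, Real.norm_of_nonneg (by positivity)]
      exact mul_le_of_le_one_right (by positivity) (abs_sign_le_one ξ)
    · refine Tendsto.const_mul _ (Tendsto.const_mul _ ?_)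
      refine (Complex.continuous_ofReal.tendsto _).comp (Tendsto.const_sub _ ?_)
      have : Continuous fun ε => sineIntegral (ξ * ε) := by fun_prop
      have h0 := this.tendsto 0
      rw [mul_zero, sineIntegral_zero] at h0
      exact h0.mono_left nhdsWithin_le_nhds

lemma norm_mul_setIntegral_exp_le {m m' : ℝ → ℂ} {S : Set ℝ} {s : ℝ} (hm : IntegrableOn m S)
    (hm' : IntegrableOn m' S)
    (h : ‖∫ ξ in S, m' ξ * Complex.exp (Complex.I * ((s * ξ : ℝ) : ℂ)) +
      m ξ * (Complex.exp (Complex.I * ((s * ξ : ℝ) : ℂ)) * (Complex.I * s))‖ ≤ ‖m 0‖) :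
    ‖∫ ξ in S, m ξ * Complex.exp (Complex.I * ((s * ξ : ℝ) : ℂ))‖ * |s| ≤
      ‖m 0‖ + ∫ ξ in S, ‖m' ξ‖ := by
  have i1 := hm'.mul_exp_I s
  have i2 := (hm.mul_exp_I s).mul_const (Complex.I * s)
  simp_rw [← mul_assoc (m _)] at h
  rw [integral_add i1 i2, integral_mul_const] at h
  have h1 : ‖∫ ξ in S, m' ξ * Complex.exp (Complex.I * ((s * ξ : ℝ) : ℂ))‖ ≤
      ∫ ξ in S, ‖m' ξ‖ := by
    refine (norm_integral_le_integral_norm _).trans (le_of_eq ?_)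
    simp_rw [norm_mul, norm_exp_I_mul, mul_one]
  have h2 : ‖(∫ ξ in S, m ξ * Complex.exp (Complex.I * ((s * ξ : ℝ) : ℂ))) * (Complex.I * s)‖ =
      ‖∫ ξ in S, m ξ * Complex.exp (Complex.I * ((s * ξ : ℝ) : ℂ))‖ * |s| := by
    simp
  rw [← h2]
  have h3 := norm_sub_le
    ((∫ ξ in S, m' ξ * Complex.exp (Complex.I * ((s * ξ : ℝ) : ℂ))) +
      (∫ ξ in S, m ξ * Complex.exp (Complex.I * ((s * ξ : ℝ) : ℂ))) * (Complex.I * s))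
    (∫ ξ in S, m' ξ * Complex.exp (Complex.I * ((s * ξ : ℝ) : ℂ)))
  rw [add_sub_cancel_left] at h3
  linarith

lemma hasDerivAt_mul_exp_I {m m' : ℝ → ℂ} {x : ℝ} (hd : HasDerivAt m (m' x) x) (s : ℝ) :
    HasDerivAt (fun ξ : ℝ => m ξ * Complex.exp (Complex.I * ((s * ξ : ℝ) : ℂ)))
      (m' x * Complex.exp (Complex.I * ((s * x : ℝ) : ℂ)) +
        m x * (Complex.exp (Complex.I * ((s * x : ℝ) : ℂ)) * (Complex.I * s))) x := by
  refine hd.mul (HasDerivAt.cexp ?_)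
  refine HasDerivAt.const_mul _ ?_
  simpa using ((hasDerivAt_id x).const_mul s).ofReal_comp

lemma norm_integral_Ioi_exp_mul_le {m m' : ℝ → ℂ} (hd : ∀ x, HasDerivAt m (m' x) x)
    (hm : Integrable m) (hm' : Integrable m') (s : ℝ) :
    ‖∫ ξ in Ioi (0 : ℝ), m ξ * Complex.exp (Complex.I * ((s * ξ : ℝ) : ℂ))‖ * |s| ≤
      ‖m 0‖ + ∫ ξ in Ioi (0 : ℝ), ‖m' ξ‖ := by
  refine norm_mul_setIntegral_exp_le hm.integrableOn hm'.integrableOn (le_of_eq ?_)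
  have hint : Integrable fun ξ : ℝ => m' ξ * Complex.exp (Complex.I * ((s * ξ : ℝ) : ℂ)) +
      m ξ * (Complex.exp (Complex.I * ((s * ξ : ℝ) : ℂ)) * (Complex.I * s)) := by
    simp_rw [← mul_assoc (m _)]
    exact (hm'.mul_exp_I s).add ((hm.mul_exp_I s).mul_const _)
  rw [integral_Ioi_of_hasDerivAt_of_tendsto' (fun x _ => hasDerivAt_mul_exp_I (hd x) s)
    hint.integrableOn (tendsto_zero_of_hasDerivAt_of_integrableOn_Ioi (a := 0)
      (fun x _ => hasDerivAt_mul_exp_I (hd x) s) hint.integrableOn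
      (hm.mul_exp_I s).integrableOn)]
  simp

lemma norm_integral_Iic_exp_mul_le {m m' : ℝ → ℂ} (hd : ∀ x, HasDerivAt m (m' x) x)
    (hm : Integrable m) (hm' : Integrable m') (s : ℝ) :
    ‖∫ ξ in Iic (0 : ℝ), m ξ * Complex.exp (Complex.I * ((s * ξ : ℝ) : ℂ))‖ * |s| ≤
      ‖m 0‖ + ∫ ξ in Iic (0 : ℝ), ‖m' ξ‖ := by
  refine norm_mul_setIntegral_exp_le hm.integrableOn hm'.integrableOn (le_of_eq ?_)
  have hint : Integrable fun ξ : ℝ => m' ξ * Complex.exp (Complex.I * ((s * ξ : ℝ) : ℂ)) +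
      m ξ * (Complex.exp (Complex.I * ((s * ξ : ℝ) : ℂ)) * (Complex.I * s)) := by
    simp_rw [← mul_assoc (m _)]
    exact (hm'.mul_exp_I s).add ((hm.mul_exp_I s).mul_const _)
  rw [integral_Iic_of_hasDerivAt_of_tendsto' (fun x _ => hasDerivAt_mul_exp_I (hd x) s)
    hint.integrableOn (tendsto_zero_of_hasDerivAt_of_integrableOn_Iic (a := 0)
      (fun x _ => hasDerivAt_mul_exp_I (hd x) s) hint.integrableOn
      (hm.mul_exp_I s).integrableOn)]
  simp

lemma MeasureTheory.Integrable.sign_mul {m : ℝ → ℂ} (hm : Integrable m) :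
    Integrable fun ξ => (Real.sign ξ : ℂ) * m ξ :=
  hm.bdd_mul (c := 1) (Complex.measurable_ofReal.comp measurable_sign).aestronglyMeasurable
    (Eventually.of_forall fun ξ => by simpa using abs_sign_le_one ξ)

lemma expTransform_eq_add {m : ℝ → ℂ} (hm : Integrable m) (s : ℝ) :
    expTransform m s = (∫ ξ in Iic (0 : ℝ), m ξ * Complex.exp (Complex.I * ((s * ξ : ℝ) : ℂ))) +
      ∫ ξ in Ioi (0 : ℝ), m ξ * Complex.exp (Complex.I * ((s * ξ : ℝ) : ℂ)) :=
  (intervalIntegral.integral_Iic_add_Ioi (hm.mul_exp_I s).integrableOn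
    (hm.mul_exp_I s).integrableOn).symm

lemma expTransform_sign_mul_eq_sub {m : ℝ → ℂ} (hm : Integrable m) (s : ℝ) :
    expTransform (fun ξ => (Real.sign ξ : ℂ) * m ξ) s =
      -(∫ ξ in Iic (0 : ℝ), m ξ * Complex.exp (Complex.I * ((s * ξ : ℝ) : ℂ))) +
      ∫ ξ in Ioi (0 : ℝ), m ξ * Complex.exp (Complex.I * ((s * ξ : ℝ) : ℂ)) := by
  rw [expTransform_eq_add hm.sign_mul]
  congr 1
  · rw [integral_Iic_eq_integral_Iio, integral_Iic_eq_integral_Iio, ← integral_neg]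
    refine setIntegral_congr_fun measurableSet_Iio fun ξ hξ => ?_
    simp [Real.sign_of_neg hξ]
  · refine setIntegral_congr_fun measurableSet_Ioi fun ξ hξ => ?_
    simp [Real.sign_of_pos hξ]

lemma integrableOn_expTransform_div_sub {m : ℝ → ℂ} (hm : Integrable m) {C : ℝ}
    (hC : ∀ s, ‖expTransform m s‖ * |s| ≤ C) (ω : ℝ) {ε : ℝ} (hε : 0 < ε) :
    IntegrableOn (fun s : ℝ => expTransform m s / ((ω : ℂ) - (s : ℂ)))
      {s : ℝ | ε < |ω - s|} := by
  have hmeas : MeasurableSet {s : ℝ | ε < |ω - s|} :=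
    measurableSet_lt measurable_const (by fun_prop)
  set K := (∫ ξ, ‖m ξ‖) * |ω| + C
  have hb : ∀ s, ‖expTransform m s‖ * |ω - s| ≤ K := fun s => by
    calc ‖expTransform m s‖ * |ω - s| ≤ ‖expTransform m s‖ * (|ω| + |s|) := by
          exact mul_le_mul_of_nonneg_left (abs_sub _ _) (norm_nonneg _)
      _ = ‖expTransform m s‖ * |ω| + ‖expTransform m s‖ * |s| := mul_add _ _ _
      _ ≤ K := add_le_add
          (mul_le_mul_of_nonneg_right (norm_expTransform_le m s) (abs_nonneg ω)) (hC s)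
  have hdom : Integrable fun s : ℝ => K * (1 + (ε ^ 2)⁻¹) * (1 + (ω - s) ^ 2)⁻¹ :=
    (integrable_inv_one_add_sq.comp_sub_left ω).const_mul _
  refine hdom.integrableOn.mono' ?_ ?_
  · have := (continuous_expTransform hm).measurable
    refine Measurable.aestronglyMeasurable ?_
    fun_prop
  · refine (ae_restrict_iff' hmeas).2 (Eventually.of_forall fun s hs => ?_)
    have hs' : ε < |ω - s| := hs
    have hpos : 0 < |ω - s| := hε.trans hs'
    have hn : ‖(ω : ℂ) - (s : ℂ)‖ = |ω - s| := by
      rw [← Complex.ofReal_sub, Complex.norm_real, Real.norm_eq_abs]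
    have hK0 : 0 ≤ K := (by positivity : (0 : ℝ) ≤ _).trans (hb s)
    have hsq : 1 + (ω - s) ^ 2 ≤ (1 + (ε ^ 2)⁻¹) * |ω - s| ^ 2 := by
      have h1 : 1 ≤ (ε ^ 2)⁻¹ * |ω - s| ^ 2 := by
        rw [← div_eq_inv_mul, one_le_div (by positivity)]
        gcongr
      rw [← sq_abs (ω - s)]
      linarith
    rw [norm_div, hn, ← div_eq_mul_inv, div_le_div_iff₀ hpos (by positivity)]
    calc ‖expTransform m s‖ * (1 + (ω - s) ^ 2)
        ≤ ‖expTransform m s‖ * ((1 + (ε ^ 2)⁻¹) * |ω - s| ^ 2) := by gcongr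
      _ = (‖expTransform m s‖ * |ω - s|) * ((1 + (ε ^ 2)⁻¹) * |ω - s|) := by ring
      _ ≤ K * ((1 + (ε ^ 2)⁻¹) * |ω - s|) := by
          gcongr
          exact hb s
      _ = K * (1 + (ε ^ 2)⁻¹) * |ω - s| := by ring

lemma exists_norm_expTransform_mul_le {m m' : ℝ → ℂ} (hd : ∀ x, HasDerivAt m (m' x) x)
    (hm : Integrable m) (hm' : Integrable m') :
    ∃ C, ∀ s, ‖expTransform m s‖ * |s| ≤ C ∧
      ‖expTransform (fun ξ => (Real.sign ξ : ℂ) * m ξ) s‖ * |s| ≤ C := by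
  refine ⟨(‖m 0‖ + ∫ ξ in Iic (0 : ℝ), ‖m' ξ‖) + (‖m 0‖ + ∫ ξ in Ioi (0 : ℝ), ‖m' ξ‖),
    fun s => ?_⟩
  have h1 := norm_integral_Iic_exp_mul_le hd hm hm' s
  have h2 := norm_integral_Ioi_exp_mul_le hd hm hm' s
  rw [expTransform_eq_add hm, expTransform_sign_mul_eq_sub hm]
  constructor
  · refine (mul_le_mul_of_nonneg_right (norm_add_le _ _) (abs_nonneg s)).trans ?_
    rw [add_mul]
    exact add_le_add h1 h2
  · refine (mul_le_mul_of_nonneg_right (norm_add_le _ _) (abs_nonneg s)).trans ?_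
    rw [add_mul, norm_neg]
    exact add_le_add h1 h2

/-- The density whose `expTransform` is `s ↦ exp(isu) N^β(s)`. -/
noncomputable def gaussSpectrum (β u ξ : ℝ) : ℂ :=
  ((Real.pi / ((β ^ 2 / 2 : ℝ) : ℂ)) ^ (1 / 2 : ℂ))⁻¹ *
    Complex.exp (-((β ^ 2 / 2 : ℝ) : ℂ) * ((ξ - u : ℝ) : ℂ) ^ 2)

lemma integrable_gaussSpectrum {β : ℝ} (hβ : 0 < β) (u : ℝ) : Integrable (gaussSpectrum β u) := by
  have hb : 0 < ((β ^ 2 / 2 : ℝ) : ℂ).re := by rw [Complex.ofReal_re]; positivity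
  exact ((integrable_cexp_neg_mul_sq hb).comp_sub_right u).const_mul _

lemma expTransform_gaussSpectrum {β : ℝ} (hβ : 0 < β) (u s : ℝ) :
    expTransform (gaussSpectrum β u) s =
      Complex.exp (Complex.I * ((s * u : ℝ) : ℂ)) * ((gaussN β s : ℝ) : ℂ) := by
  have hb : 0 < ((β ^ 2 / 2 : ℝ) : ℂ).re := by rw [Complex.ofReal_re]; positivity
  have hβ' : (β : ℂ) ≠ 0 := by exact_mod_cast hβ.ne'
  have hne : (Real.pi / ((β ^ 2 / 2 : ℝ) : ℂ)) ^ (1 / 2 : ℂ) ≠ 0 := by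
    rw [Ne, Complex.cpow_eq_zero_iff, not_and_or]
    left
    have : (Real.pi : ℂ) ≠ 0 := by exact_mod_cast Real.pi_ne_zero
    exact div_ne_zero this fun h => by rw [h] at hb; simp at hb
  rw [expTransform, ← integral_add_right_eq_self _ u]
  have hfun : ∀ x : ℝ, gaussSpectrum β u (x + u) *
      Complex.exp (Complex.I * ((s * (x + u) : ℝ) : ℂ)) =
      (((Real.pi / ((β ^ 2 / 2 : ℝ) : ℂ)) ^ (1 / 2 : ℂ))⁻¹ *
        Complex.exp (Complex.I * ((s * u : ℝ) : ℂ))) *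
      (Complex.exp (Complex.I * (s : ℂ) * x) *
        Complex.exp (-((β ^ 2 / 2 : ℝ) : ℂ) * (x : ℂ) ^ 2)) := fun x => by
    have : Complex.exp (Complex.I * ((s * (x + u) : ℝ) : ℂ)) =
        Complex.exp (Complex.I * ((s * u : ℝ) : ℂ)) * Complex.exp (Complex.I * (s : ℂ) * x) := by
      rw [← Complex.exp_add]
      congr 1
      push_cast
      ring
    rw [gaussSpectrum, this, add_sub_cancel_right]
    ring
  simp_rw [hfun]
  rw [integral_const_mul, fourierIntegral_gaussian hb, gaussN, Complex.ofReal_exp]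
  have hexp : -(s : ℂ) ^ 2 / (4 * ((β ^ 2 / 2 : ℝ) : ℂ)) =
      ((-(s ^ 2) / (2 * β ^ 2) : ℝ) : ℂ) := by
    push_cast
    field_simp
    norm_num
  rw [hexp]
  field_simp

lemma exists_norm_expTransform_gaussSpectrum_mul_le {β : ℝ} (hβ : 0 < β) (u : ℝ) :
    ∃ C, ∀ s, ‖expTransform (gaussSpectrum β u) s‖ * |s| ≤ C ∧
      ‖expTransform (fun ξ => (Real.sign ξ : ℂ) * gaussSpectrum β u ξ) s‖ * |s| ≤ C := by
  have hb : 0 < ((β ^ 2 / 2 : ℝ) : ℂ).re := by rw [Complex.ofReal_re]; positivity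
  set b := ((β ^ 2 / 2 : ℝ) : ℂ) with hb_def
  set c := ((Real.pi / b) ^ (1 / 2 : ℂ))⁻¹ with hc_def
  refine exists_norm_expTransform_mul_le (m' := fun ξ => c * (-2 * b) *
    (((ξ - u : ℝ) : ℂ) * Complex.exp (-b * ((ξ - u : ℝ) : ℂ) ^ 2))) (fun x => ?_)
    (integrable_gaussSpectrum hβ u)
    (((integrable_mul_cexp_neg_mul_sq hb).comp_sub_right u).const_mul _)
  have h1 : HasDerivAt (fun ξ : ℝ => ((ξ - u : ℝ) : ℂ)) 1 x := by
    simpa using ((hasDerivAt_id x).sub_const u).ofReal_comp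
  have h2 := ((((h1.pow 2).const_mul (-b))).cexp).const_mul c
  refine h2.congr_deriv ?_
  simp
  ring

lemma expTransform_sign_mul_sign_mul (m : ℝ → ℂ) (s : ℝ) :
    expTransform (fun ξ => (Real.sign ξ : ℂ) * ((Real.sign ξ : ℂ) * m ξ)) s =
      expTransform m s := by
  refine integral_congr_ae ?_
  filter_upwards [compl_mem_ae_iff.2 (measure_singleton (0 : ℝ))] with ξ hξ
  rcases lt_or_gt_of_ne (show ξ ≠ 0 from hξ) with h | h
  · simp [Real.sign_of_neg h]
  · simp [Real.sign_of_pos h]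

/-- Inversion law `-(H^u)² f = f` of the conjugated Hilbert transform
`H^u f(ω) = exp(-iωu) (1/π) p.v.∫ exp(isu) f(s)/(ω-s) ds`, stated for the Gaussian
`f = N^β`: (i) the principal-value limit defining `g = H^u N^β` exists at every `ω`;
(ii) the principal-value limit defining `H^u g` exists at every `ω`; and
(iii) `H^u (H^u N^β)(ω) = -N^β(ω)` for all `ω`. -/
theorem conjugated_hilbert_inversion_gaussian (β u : ℝ) (hβ : 0 < β) :
    ∃ g : ℝ → ℂ,
      (∀ ω : ℝ,
        Filter.Tendsto (fun ε : ℝ =>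
            Complex.exp (-Complex.I * ((ω * u : ℝ) : ℂ)) * ((1 / Real.pi : ℝ) : ℂ) *
              ∫ s in {s : ℝ | ε < |ω - s|},
                Complex.exp (Complex.I * ((s * u : ℝ) : ℂ)) * ((gaussN β s : ℝ) : ℂ) /
                  (((ω : ℝ) : ℂ) - ((s : ℝ) : ℂ)))
          (nhdsWithin (0 : ℝ) (Set.Ioi 0)) (nhds (g ω))) ∧
      (∀ ω : ℝ,
        Filter.Tendsto (fun ε : ℝ =>
            Complex.exp (-Complex.I * ((ω * u : ℝ) : ℂ)) * ((1 / Real.pi : ℝ) : ℂ) *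
              ∫ s in {s : ℝ | ε < |ω - s|},
                Complex.exp (Complex.I * ((s * u : ℝ) : ℂ)) * g s /
                  (((ω : ℝ) : ℂ) - ((s : ℝ) : ℂ)))
          (nhdsWithin (0 : ℝ) (Set.Ioi 0)) (nhds (-((gaussN β ω : ℝ) : ℂ)))) := by
  have hpi : (Real.pi : ℂ) ≠ 0 := by exact_mod_cast Real.pi_ne_zero
  have hm := integrable_gaussSpectrum hβ u
  obtain ⟨C, hC⟩ := exists_norm_expTransform_gaussSpectrum_mul_le hβ u
  refine ⟨fun ω => Complex.exp (-Complex.I * ((ω * u : ℝ) : ℂ)) * ((1 / Real.pi : ℝ) : ℂ) *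
    (-(Complex.I * Real.pi) *
      expTransform (fun ξ => (Real.sign ξ : ℂ) * gaussSpectrum β u ξ) ω), fun ω => ?_, fun ω => ?_⟩
  · simp_rw [← expTransform_gaussSpectrum hβ u]
    exact (tendsto_principalValue_expTransform hm ω fun ε hε =>
      integrableOn_expTransform_div_sub hm (fun s => (hC s).1) ω hε).const_mul _
  · have hcancel : ∀ x : ℝ, Complex.exp (Complex.I * (x : ℂ)) * Complex.exp (-Complex.I * (x : ℂ)) =
        1 := fun x => by rw [← Complex.exp_add]; simp
    have hfun : ∀ s : ℝ, Complex.exp (Complex.I * ((s * u : ℝ) : ℂ)) *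
        (Complex.exp (-Complex.I * ((s * u : ℝ) : ℂ)) * ((1 / Real.pi : ℝ) : ℂ) *
          (-(Complex.I * Real.pi) *
            expTransform (fun ξ => (Real.sign ξ : ℂ) * gaussSpectrum β u ξ) s)) /
          ((ω : ℂ) - (s : ℂ)) =
        -Complex.I * (expTransform (fun ξ => (Real.sign ξ : ℂ) * gaussSpectrum β u ξ) s /
          ((ω : ℂ) - (s : ℂ))) := fun s => by
      rw [← mul_assoc, ← mul_assoc (Complex.exp _), hcancel, ← mul_div_assoc]
      congr 1
      push_cast
      field_simp
    simp_rw [hfun, integral_const_mul]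
    have h := ((tendsto_principalValue_expTransform hm.sign_mul ω fun ε hε =>
      integrableOn_expTransform_div_sub hm.sign_mul (fun s => (hC s).2) ω hε).const_mul
        (-Complex.I)).const_mul
        (Complex.exp (-Complex.I * ((ω * u : ℝ) : ℂ)) * ((1 / Real.pi : ℝ) : ℂ))
    rw [expTransform_sign_mul_sign_mul, expTransform_gaussSpectrum hβ] at h
    convert h using 2
    have h1 := hcancel (ω * u)
    generalize Complex.exp (Complex.I * ((ω * u : ℝ) : ℂ)) = a at *
    generalize Complex.exp (-Complex.I * ((ω * u : ℝ) : ℂ)) = a' at *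
    push_cast
    field_simp
    linear_combination (gaussN β ω : ℂ) * h1 - (gaussN β ω : ℂ) * a * a' * Complex.I_sq
end
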